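/- Let n, m, l, k, t be positive integers with 3 ≤ t ≤ l ≤ k and min{m, n} ≥ (t+1)(k−t+1), and let 𝒜 ⊆ C([n],k) and ℬ ⊆ C([m],l) be cross-t-intersecting families. Then |𝒜|·|ℬ| = C(n−t, k−t)·C(m−t, l−t) if and only if one of the following holds: (1) there is a t-element subset T ⊆ [min{m,n}] such that 𝒜 = {A ∈ C([n],k) : T ⊆ A} and ℬ = {B ∈ C([m],l) : T ⊆ B}; or (2) n = m = (t+1)(k−t+1), k = l, and there is a (t+2)-element subset T ⊆ [n] such that 𝒜 = ℬ = {A ∈ C([n],k) : |A ∩ T| ≥ t+1}. -/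

import Mathlib

namespace CrossIntersecting

open Finset

/-- The family of all `k`-element subsets of `{1, …, n}`. -/
abbrev level (n k : ℕ) : Finset (Finset ℕ) := (Icc 1 n).powersetCard k

/-- Cross-`t`-intersecting subfamilies of `level n k` and `level m l`. -/
structure IsCross (t n k m l : ℕ) (𝒜 ℬ : Finset (Finset ℕ)) : Prop where
  left : 𝒜 ⊆ level n k
  right : ℬ ⊆ level m l
  cross : ∀ A ∈ 𝒜, ∀ B ∈ ℬ, t ≤ #(A ∩ B)

/-- Cross-`t`-intersecting pairs with the largest product of sizes. -/
structure IsOptimal (t n k m l : ℕ) (𝒜 ℬ : Finset (Finset ℕ)) : Prop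
    extends IsCross t n k m l 𝒜 ℬ where
  le : ∀ 𝒜' ℬ', IsCross t n k m l 𝒜' ℬ' → #𝒜' * #ℬ' ≤ #𝒜 * #ℬ

/-- Left-compressed families of sets of positive integers. -/
def IsShifted (𝒜 : Finset (Finset ℕ)) : Prop :=
  ∀ A ∈ 𝒜, ∀ x y, 1 ≤ x → x < y → y ∈ A → x ∉ A → insert x (A.erase y) ∈ 𝒜

section Counting

variable {n k i : ℕ} {T E : Finset ℕ} {𝒯 : Finset (Finset ℕ)}

lemma card_filter_inter_eq (hT : T ⊆ Icc 1 n) (hE : E ⊆ T) (hk : #E ≤ k) :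
    #{A ∈ level n k | A ∩ T = E} = (n - #T).choose (k - #E) := by
  have hcard : #(Icc 1 n \ T) = n - #T := by
    rw [card_sdiff_of_subset hT, Nat.card_Icc]; simp
  rw [← hcard, ← card_powersetCard]
  refine card_nbij' (· \ T) (· ∪ E) ?_ ?_ ?_ ?_
  · intro A hA
    simp only [mem_coe, mem_filter, mem_powersetCard] at hA ⊢
    obtain ⟨⟨hAn, rfl⟩, rfl⟩ := hA
    refine ⟨sdiff_subset_sdiff hAn subset_rfl, ?_⟩
    have := card_sdiff_add_card_inter A T
    omega
  · intro D hD
    simp only [mem_coe, mem_filter, mem_powersetCard] at hD ⊢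
    obtain ⟨hDn, hDk⟩ := hD
    have hDT : Disjoint D T := disjoint_of_subset_left hDn sdiff_disjoint
    refine ⟨⟨union_subset (hDn.trans sdiff_subset) (hE.trans hT), ?_⟩, ?_⟩
    · rw [card_union_of_disjoint (disjoint_of_subset_right hE hDT)]; omega
    · rw [union_inter_distrib_right, disjoint_iff_inter_eq_empty.1 hDT, empty_union,
        inter_eq_left.2 hE]
  · intro A hA
    simp only [mem_coe, mem_filter, mem_powersetCard] at hA
    rw [← hA.2]
    exact sdiff_union_inter A T
  · intro D hD
    simp only [mem_coe, mem_powersetCard] at hD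
    have hDT : Disjoint D T := disjoint_of_subset_left hD.1 sdiff_disjoint
    show (D ∪ E) \ T = D
    rw [union_sdiff_distrib, sdiff_eq_self_of_disjoint hDT, sdiff_eq_empty_iff_subset.2 hE,
      union_empty]

lemma card_filter_inter_mem (hT : T ⊆ Icc 1 n) (h𝒯 : ∀ E ∈ 𝒯, E ⊆ T ∧ #E = i) (hi : i ≤ k) :
    #{A ∈ level n k | A ∩ T ∈ 𝒯} = #𝒯 * (n - #T).choose (k - i) := by
  rw [card_eq_sum_card_fiberwise (f := (· ∩ T)) (t := 𝒯) (fun A hA => by simp_all)]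
  rw [sum_const_nat (m := (n - #T).choose (k - i))]
  intro E hE
  obtain ⟨hET, rfl⟩ := h𝒯 E hE
  rw [← card_filter_inter_eq hT hET hi, filter_filter]
  congr 1
  ext A
  simp only [mem_filter]
  constructor
  · rintro ⟨h, -, h'⟩; exact ⟨h, h'⟩
  · rintro ⟨h, rfl⟩; exact ⟨h, hE, rfl⟩

lemma exists_inter_eq (hT : T ⊆ Icc 1 n) (hE : E ⊆ T) (hk : #E ≤ k) (hn : k - #E ≤ n - #T) :
    ∃ A ∈ level n k, A ∩ T = E := by
  have h : 0 < #{A ∈ level n k | A ∩ T = E} := by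
    rw [card_filter_inter_eq hT hE hk]; exact Nat.choose_pos hn
  obtain ⟨A, hA⟩ := card_pos.1 h
  exact ⟨A, (mem_filter.1 hA).1, (mem_filter.1 hA).2⟩

end Counting

/-- The numerical hypotheses, in a form symmetric in `(n, k)` and `(m, l)`. -/
structure Admissible (t n k m l : ℕ) : Prop where
  three_le : 3 ≤ t
  le_left : t ≤ k
  le_right : t ≤ l
  left_left : (t + 1) * (k - t + 1) ≤ n
  left_right : (t + 1) * (l - t + 1) ≤ n
  right_left : (t + 1) * (k - t + 1) ≤ m
  right_right : (t + 1) * (l - t + 1) ≤ m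

section Basic

variable {t n k m l s : ℕ} {𝒜 ℬ : Finset (Finset ℕ)} {A B E F : Finset ℕ}

lemma Admissible.symm (h : Admissible t n k m l) : Admissible t m l n k :=
  ⟨h.1, h.3, h.2, h.7, h.6, h.5, h.4⟩

lemma Admissible.le_n (h : Admissible t n k m l) : 2 * (k - t) + 2 * (l - t) + t + 1 ≤ n := by
  have := h.three_le
  have := h.left_left
  have := h.left_right
  nlinarith

lemma IsCross.symm (h : IsCross t n k m l 𝒜 ℬ) : IsCross t m l n k ℬ 𝒜 :=
  ⟨h.2, h.1, fun B hB A hA => by rw [inter_comm]; exact h.3 A hA B hB⟩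

lemma IsOptimal.symm (h : IsOptimal t n k m l 𝒜 ℬ) : IsOptimal t m l n k ℬ 𝒜 :=
  ⟨h.toIsCross.symm, fun ℬ' 𝒜' h' => by
    rw [mul_comm, mul_comm #ℬ]; exact h.le 𝒜' ℬ' h'.symm⟩

/-- The sets of size `k` meeting `T` in at least `a` elements. -/
abbrev frankl (n k a : ℕ) (T : Finset ℕ) : Finset (Finset ℕ) := {A ∈ level n k | a ≤ #(A ∩ T)}

lemma isCross_frankl {a : ℕ} {T : Finset ℕ} (h : #T + t ≤ 2 * a) :
    IsCross t n k m l (frankl n k a T) (frankl m l a T) := by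
  refine ⟨filter_subset _ _, filter_subset _ _, fun A hA B hB => ?_⟩
  have hA := (mem_filter.1 hA).2
  have hB := (mem_filter.1 hB).2
  have h1 := card_union_add_card_inter (A ∩ T) (B ∩ T)
  have h2 := card_le_card (union_subset (inter_subset_right (s₁ := A) (s₂ := T))
    (inter_subset_right (s₁ := B) (s₂ := T)))
  have h3 : #(A ∩ T ∩ (B ∩ T)) ≤ #(A ∩ B) :=
    card_le_card (inter_subset_inter inter_subset_left inter_subset_left)
  omega

lemma star_eq_frankl {T : Finset ℕ} :
    {A ∈ level n k | T ⊆ A} = frankl n k #T T := by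
  ext A
  simp only [mem_filter, and_congr_right_iff]
  intro _
  rw [← inter_eq_right]
  exact ⟨fun h => by rw [h], fun h => eq_of_subset_of_card_le inter_subset_right h⟩

lemma card_star {T : Finset ℕ} (hT : T ⊆ Icc 1 n) (hk : #T ≤ k) :
    #(frankl n k #T T) = (n - #T).choose (k - #T) := by
  rw [← star_eq_frankl, ← card_filter_inter_eq hT subset_rfl hk]
  simp only [inter_eq_right]

lemma Admissible.choose_pos (h : Admissible t n k m l) :
    0 < (n - t).choose (k - t) * (m - t).choose (l - t) := by
  have := h.le_n
  have := h.symm.le_n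
  exact Nat.mul_pos (Nat.choose_pos (by omega)) (Nat.choose_pos (by omega))

lemma exists_isOptimal (t n k m l : ℕ) : ∃ 𝒜 ℬ, IsOptimal t n k m l 𝒜 ℬ := by
  classical
  let S := ((level n k).powerset ×ˢ (level m l).powerset).filter
    fun p => IsCross t n k m l p.1 p.2
  have hS : S.Nonempty := ⟨(∅, ∅), by
    simp only [S, mem_filter, mem_product, mem_powerset]
    exact ⟨⟨by simp, by simp⟩, by simp, by simp, by simp⟩⟩
  obtain ⟨p, hp, hmax⟩ := exists_max_image S (fun p => #p.1 * #p.2) hS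
  refine ⟨p.1, p.2, (mem_filter.1 hp).2, fun 𝒜' ℬ' h' => hmax (𝒜', ℬ') ?_⟩
  simp only [S, mem_filter, mem_product, mem_powerset]
  exact ⟨⟨h'.left, h'.right⟩, h'⟩

lemma IsOptimal.choose_le (h : IsOptimal t n k m l 𝒜 ℬ) (hp : Admissible t n k m l) :
    (n - t).choose (k - t) * (m - t).choose (l - t) ≤ #𝒜 * #ℬ := by
  have h1 := hp.le_n
  have h2 := hp.symm.le_n
  have hT : #(Icc 1 t) = t := by simp
  have := h.le _ _ (isCross_frankl (T := Icc 1 t) (a := #(Icc 1 t)) (by omega))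
  rwa [card_star (Icc_subset_Icc_right (by omega)) (hT.trans_le hp.le_left),
    card_star (Icc_subset_Icc_right (by omega)) (hT.trans_le hp.le_right), hT] at this

lemma IsOptimal.left_nonempty (h : IsOptimal t n k m l 𝒜 ℬ) (hp : Admissible t n k m l) :
    𝒜.Nonempty := by
  rw [nonempty_iff_ne_empty]
  rintro rfl
  have := hp.choose_pos
  have := h.choose_le hp
  simp only [card_empty] at this
  omega

lemma IsOptimal.eq_of_subset {𝒜' ℬ' : Finset (Finset ℕ)} (h : IsOptimal t n k m l 𝒜 ℬ)
    (hp : Admissible t n k m l) (h' : IsCross t n k m l 𝒜' ℬ') (h𝒜 : 𝒜 ⊆ 𝒜') (hℬ : ℬ ⊆ ℬ') :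
    𝒜 = 𝒜' ∧ ℬ = ℬ' := by
  have h1 := card_pos.2 (h.left_nonempty hp)
  have h2 := card_pos.2 (h.symm.left_nonempty hp.symm)
  have h3 := h.le _ _ h'
  have h4 := card_le_card h𝒜
  have h5 := card_le_card hℬ
  exact ⟨eq_of_subset_of_card_le h𝒜 (by nlinarith), eq_of_subset_of_card_le hℬ (by nlinarith)⟩

end Basic

section Traces

variable {t n k m l s : ℕ} {𝒜 ℬ : Finset (Finset ℕ)} {A B E F : Finset ℕ}

/-- The traces of the members of `𝒜` on `{1, …, s}`. -/
def trace (s : ℕ) (𝒜 : Finset (Finset ℕ)) : Finset (Finset ℕ) := 𝒜.image (· ∩ Icc 1 s)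

lemma mem_trace : E ∈ trace s 𝒜 ↔ ∃ A ∈ 𝒜, A ∩ Icc 1 s = E := mem_image

lemma subset_of_mem_trace (h : E ∈ trace s 𝒜) : E ⊆ Icc 1 s := by
  obtain ⟨A, -, rfl⟩ := mem_trace.1 h
  exact inter_subset_right

/-- The traces on `{1, …, s}` are already cross-`t`-intersecting. -/
def TraceCross (t s : ℕ) (𝒜 ℬ : Finset (Finset ℕ)) : Prop :=
  ∀ E ∈ trace s 𝒜, ∀ F ∈ trace s ℬ, t ≤ #(E ∩ F)

lemma TraceCross.symm (h : TraceCross t s 𝒜 ℬ) : TraceCross t s ℬ 𝒜 :=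
  fun E hE F hF => by rw [inter_comm]; exact h F hF E hE

lemma IsShifted.trace (h : IsShifted 𝒜) (hE : E ∈ trace s 𝒜) {x y : ℕ} (hx : 1 ≤ x) (hxy : x < y)
    (hyE : y ∈ E) (hxE : x ∉ E) : insert x (E.erase y) ∈ CrossIntersecting.trace s 𝒜 := by
  obtain ⟨A, hA, rfl⟩ := mem_trace.1 hE
  have hys := mem_Icc.1 (mem_inter.1 hyE).2
  have hxs : x ∈ Icc 1 s := mem_Icc.2 ⟨hx, by omega⟩
  refine mem_trace.2 ⟨_, h A hA x y hx hxy (mem_inter.1 hyE).1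
    (fun hxA => hxE (mem_inter.2 ⟨hxA, hxs⟩)), ?_⟩
  rw [insert_inter_of_mem hxs, erase_inter]

lemma trace_cross_of_isShifted (h : IsCross t n k m l 𝒜 ℬ) (h𝒜 : IsShifted 𝒜) (ht : t ≤ k) :
    TraceCross t (k + l - t) 𝒜 ℬ := by
  suffices H : ∀ N, ∀ A ∈ 𝒜, ∀ B ∈ ℬ, A.sum id ≤ N →
      t ≤ #(A ∩ Icc 1 (k + l - t) ∩ (B ∩ Icc 1 (k + l - t))) by
    intro E hE F hF
    obtain ⟨A, hA, rfl⟩ := mem_trace.1 hE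
    obtain ⟨B, hB, rfl⟩ := mem_trace.1 hF
    exact H _ A hA B hB le_rfl
  intro N
  induction N with
  | zero =>
    intro A hA B hB hsum
    have hAn := mem_powersetCard.1 (h.left hA)
    have : A = ∅ := by
      rw [eq_empty_iff_forall_notMem]
      intro a ha
      have h1 := single_le_sum (f := id) (fun _ _ => Nat.zero_le _) ha
      have h2 := mem_Icc.1 (hAn.1 ha)
      simp only [id] at h1 hsum
      omega
    have := h.cross A hA B hB
    subst A
    simp_all
  | succ N ih =>
    intro A hA B hB hsum
    have hAn := mem_powersetCard.1 (h.left hA)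
    have hBm := mem_powersetCard.1 (h.right hB)
    have hAB := h.cross A hA B hB
    by_contra! hlt
    have hy : ¬ A ∩ B ⊆ Icc 1 (k + l - t) := fun hsub => by
      have : A ∩ B ⊆ A ∩ Icc 1 (k + l - t) ∩ (B ∩ Icc 1 (k + l - t)) := fun a ha => by
        have := hsub ha
        simp_all
      have := card_le_card this
      omega
    obtain ⟨y, hyAB, hy⟩ := not_subset.1 hy
    have hyA := (mem_inter.1 hyAB).1
    have hyB := (mem_inter.1 hyAB).2
    have hx : ¬ Icc 1 (k + l - t) ⊆ A ∪ B := fun hsub => by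
      have h1 : insert y (Icc 1 (k + l - t)) ⊆ A ∪ B :=
        insert_subset (mem_union_left _ hyA) hsub
      have h2 := card_le_card h1
      rw [card_insert_of_notMem hy, Nat.card_Icc] at h2
      have h3 := card_union_add_card_inter A B
      omega
    obtain ⟨x, hxs, hx⟩ := not_subset.1 hx
    rw [mem_union, not_or] at hx
    have hxI := mem_Icc.1 hxs
    have hy1 := (mem_Icc.1 (hAn.1 hyA)).1
    rw [mem_Icc] at hy
    have hxy : x < y := by omega
    have := ih _ (h𝒜 A hA x y hxI.1 hxy hyA hx.1) B hB (by
      rw [sum_insert (fun h => hx.1 (mem_of_mem_erase h))]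
      have := add_sum_erase A id hyA
      simp only [id] at this hsum ⊢
      omega)
    refine absurd (this.trans (card_le_card ?_)) (not_le.2 hlt)
    intro a ha
    simp only [mem_inter, mem_insert, mem_erase] at ha ⊢
    obtain ⟨⟨rfl | h1, h2⟩, h3⟩ := ha
    · exact absurd h3.1 hx.2
    · exact ⟨⟨h1.2, h2⟩, h3⟩

lemma mem_of_trace_subset (h : IsOptimal t n k m l 𝒜 ℬ) (hp : Admissible t n k m l)
    (hs : TraceCross t s 𝒜 ℬ) (hE : E ∈ trace s 𝒜) (hA : A ∈ level n k)
    (hEA : E ⊆ A ∩ Icc 1 s) : A ∈ 𝒜 := by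
  refine insert_eq_self.1 (h.eq_of_subset hp (𝒜' := insert A 𝒜) (ℬ' := ℬ)
    ⟨insert_subset hA h.left, h.right, ?_⟩ (subset_insert _ _) subset_rfl).1.symm
  intro A' hA' B hB
  rcases mem_insert.1 hA' with rfl | hA'
  · exact (hs E hE _ (mem_trace.2 ⟨B, hB, rfl⟩)).trans
      (card_le_card (inter_subset_inter (hEA.trans inter_subset_left) inter_subset_left))
  · exact h.cross A' hA' B hB

lemma mem_iff_trace (h : IsOptimal t n k m l 𝒜 ℬ) (hp : Admissible t n k m l)
    (hs : TraceCross t s 𝒜 ℬ) (hA : A ∈ level n k) : A ∈ 𝒜 ↔ A ∩ Icc 1 s ∈ trace s 𝒜 :=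
  ⟨fun h => mem_trace.2 ⟨A, h, rfl⟩, fun h' => mem_of_trace_subset h hp hs h' hA subset_rfl⟩

lemma card_mem_trace (h : IsOptimal t n k m l 𝒜 ℬ) (hp : Admissible t n k m l)
    (hs : TraceCross t s 𝒜 ℬ) (hE : E ∈ trace s 𝒜) : t ≤ #E ∧ #E ≤ k := by
  constructor
  · obtain ⟨B, hB⟩ := h.symm.left_nonempty hp.symm
    exact (hs E hE _ (mem_trace.2 ⟨B, hB, rfl⟩)).trans (card_le_card inter_subset_left)
  · obtain ⟨A, hA, rfl⟩ := mem_trace.1 hE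
    rw [← (mem_powersetCard.1 (h.left hA)).2]
    exact card_le_card inter_subset_left

lemma trace_upward (h : IsOptimal t n k m l 𝒜 ℬ) (hp : Admissible t n k m l)
    (hs : TraceCross t s 𝒜 ℬ) (hsk : s ≤ k + l - t) (hE : E ∈ trace s 𝒜) {E' : Finset ℕ}
    (hEE' : E ⊆ E') (hE' : E' ⊆ Icc 1 s) (hk : #E' ≤ k) : E' ∈ trace s 𝒜 := by
  have h1 := hp.le_n
  have h2 := hp.le_left
  have h3 := hp.le_right
  have h4 := (card_mem_trace h hp hs hE).1.trans (card_le_card hEE')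
  obtain ⟨A, hA, rfl⟩ := exists_inter_eq (n := n) (k := k) (Icc_subset_Icc_right (by omega)) hE' hk
    (by rw [Nat.card_Icc]; omega)
  exact mem_trace.2 ⟨A, mem_of_trace_subset h hp hs hE hA hEE', rfl⟩

lemma union_eq_of_card_inter (hs : TraceCross t s 𝒜 ℬ) (h𝒜 : IsShifted 𝒜) (hE : E ∈ trace s 𝒜)
    (hF : F ∈ trace s ℬ) (hsE : s ∈ E) (hsF : s ∈ F) (hEF : #(E ∩ F) ≤ t) :
    E ∪ F = Icc 1 s := by
  refine subset_antisymm (union_subset (subset_of_mem_trace hE) (subset_of_mem_trace hF)) ?_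
  intro x hx
  by_contra hxEF
  rw [mem_union, not_or] at hxEF
  have hx' := mem_Icc.1 hx
  have hxs : x < s := lt_of_le_of_ne hx'.2 (by rintro rfl; exact hxEF.1 hsE)
  have h1 := hs _ (h𝒜.trace hE hx'.1 hxs hsE hxEF.1) F hF
  rw [insert_inter_of_notMem hxEF.2, erase_inter, card_erase_of_mem (mem_inter.2 ⟨hsE, hsF⟩)] at h1
  have := card_pos.2 ⟨s, mem_inter.2 ⟨hsE, hsF⟩⟩
  omega

lemma card_add_card_of_card_inter (hs : TraceCross t s 𝒜 ℬ) (h𝒜 : IsShifted 𝒜)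
    (hE : E ∈ trace s 𝒜) (hF : F ∈ trace s ℬ) (hsE : s ∈ E) (hsF : s ∈ F) (hEF : #(E ∩ F) ≤ t) :
    #E + #F = s + t := by
  have h1 := card_union_add_card_inter E F
  rw [union_eq_of_card_inter hs h𝒜 hE hF hsE hsF hEF, Nat.card_Icc] at h1
  have := hs E hE F hF
  omega

/-- The traces of size `i` containing `s` which are no longer traces once `s` is removed. -/
def critical (s i : ℕ) (𝒜 : Finset (Finset ℕ)) : Finset (Finset ℕ) :=
  {E ∈ trace s 𝒜 | s ∈ E ∧ #E = i ∧ E.erase s ∉ trace s 𝒜}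

lemma mem_critical {i : ℕ} :
    E ∈ critical s i 𝒜 ↔ E ∈ trace s 𝒜 ∧ s ∈ E ∧ #E = i ∧ E.erase s ∉ trace s 𝒜 := mem_filter

lemma le_card_erase_inter {i j : ℕ} (hs : TraceCross t s 𝒜 ℬ) (h𝒜 : IsShifted 𝒜)
    (hij : i + j = s + t) (hE : E ∈ critical s i 𝒜) (hF : F ∈ trace s ℬ)
    (hF' : F ∉ critical s j ℬ) : t ≤ #(E.erase s ∩ F) := by
  obtain ⟨hE', hsE, rfl, -⟩ := mem_critical.1 hE
  by_cases hsF : s ∈ F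
  · by_cases hFs : F.erase s ∈ trace s ℬ
    · have := hs E hE' _ hFs
      rwa [inter_erase, ← erase_inter] at this
    · by_contra! hlt
      rw [erase_inter, card_erase_of_mem (mem_inter.2 ⟨hsE, hsF⟩)] at hlt
      have := card_add_card_of_card_inter hs h𝒜 hE' hF hsE hsF (by omega)
      exact hF' (mem_critical.2 ⟨hF, hsF, by omega, hFs⟩)
  · have := hs E hE' F hF
    rwa [erase_inter, erase_eq_of_notMem (fun h => hsF (mem_inter.1 h).2)]

end Traces

section Exchange

variable {t n k m l s i j : ℕ} {𝒜 ℬ : Finset (Finset ℕ)} {A B E F : Finset ℕ}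

/-- The members of `𝒜` whose trace is critical. -/
abbrev criticalMembers (s i n k : ℕ) (𝒜 : Finset (Finset ℕ)) : Finset (Finset ℕ) :=
  {A ∈ level n k | A ∩ Icc 1 s ∈ critical s i 𝒜}

lemma card_criticalMembers (hsn : s ≤ n) (hi : i ≤ k) :
    #(criticalMembers s i n k 𝒜) = #(critical s i 𝒜) * (n - s).choose (k - i) := by
  rw [criticalMembers, card_filter_inter_mem (i := i) (Icc_subset_Icc_right hsn) _ hi]
  · simp
  · intro E hE
    have hE := mem_critical.1 hE
    exact ⟨subset_of_mem_trace hE.1, hE.2.2.1⟩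

lemma criticalMembers_subset (h : IsOptimal t n k m l 𝒜 ℬ) (hp : Admissible t n k m l)
    (hs : TraceCross t s 𝒜 ℬ) : criticalMembers s i n k 𝒜 ⊆ 𝒜 := fun A hA => by
  have hA := mem_filter.1 hA
  exact (mem_iff_trace h hp hs hA.1).2 (mem_critical.1 hA.2).1

lemma Admissible.le_of_le (hp : Admissible t n k m l) (hsk : s ≤ k + l - t) : s ≤ n := by
  have := hp.le_n
  have := hp.le_left
  have := hp.le_right
  omega

/-- Dropping `s` from the critical traces on one side and giving up those on the other side. -/
lemma exchange_le (h : IsOptimal t n k m l 𝒜 ℬ) (hp : Admissible t n k m l)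
    (hs : TraceCross t s 𝒜 ℬ) (h𝒜 : IsShifted 𝒜) (hsk : s ≤ k + l - t) (hij : i + j = s + t)
    (hi : 1 ≤ i) (hik : i ≤ k) (hjl : j ≤ l) :
    (#𝒜 + #(critical s i 𝒜) * (n - s).choose (k - i + 1)) *
      (#ℬ - #(critical s j ℬ) * (m - s).choose (l - j)) ≤ #𝒜 * #ℬ := by
  have hsn : s ≤ n := hp.le_of_le hsk
  have hsm : s ≤ m := hp.symm.le_of_le (by omega)
  set 𝒯 := (critical s i 𝒜).image (erase · s) with h𝒯
  have hcard𝒯 : #𝒯 = #(critical s i 𝒜) := by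
    refine card_image_of_injOn fun E hE F hF hEF => ?_
    have hE := (mem_critical.1 hE).2.1
    have hF := (mem_critical.1 hF).2.1
    rw [← insert_erase hE, ← insert_erase hF]
    exact congrArg (insert s) hEF
  set 𝒩 : Finset (Finset ℕ) := {A ∈ level n k | A ∩ Icc 1 s ∈ 𝒯} with h𝒩
  have hcard𝒩 : #𝒩 = #(critical s i 𝒜) * (n - s).choose (k - i + 1) := by
    rw [h𝒩, card_filter_inter_mem (i := i - 1) (Icc_subset_Icc_right hsn) _ (by omega), hcard𝒯,
      Nat.card_Icc, Nat.add_sub_cancel, show k - (i - 1) = k - i + 1 by omega]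
    intro E hE
    obtain ⟨E, hE', rfl⟩ := mem_image.1 hE
    have hE := mem_critical.1 hE'
    exact ⟨(erase_subset _ _).trans (subset_of_mem_trace hE.1), by
      rw [card_erase_of_mem hE.2.1, hE.2.2.1]⟩
  have hdisj : Disjoint 𝒜 𝒩 := by
    rw [disjoint_left]
    intro A hA hA'
    obtain ⟨E, hE, hEA⟩ := mem_image.1 (mem_filter.1 hA').2
    exact (mem_critical.1 hE).2.2.2 (by
      rw [hEA]; exact mem_trace.2 ⟨A, hA, rfl⟩)
  rw [← hcard𝒩, ← card_union_of_disjoint hdisj, ← card_criticalMembers hsm hjl,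
    ← card_sdiff_of_subset (criticalMembers_subset h.symm hp.symm hs.symm)]
  refine h.le _ _ ⟨union_subset h.left (filter_subset _ _), sdiff_subset.trans h.right, ?_⟩
  intro A hA B hB
  obtain ⟨hB, hB'⟩ := mem_sdiff.1 hB
  rcases mem_union.1 hA with hA | hA
  · exact h.cross A hA B hB
  · obtain ⟨E, hE, hEA⟩ := mem_image.1 (mem_filter.1 hA).2
    have := le_card_erase_inter hs h𝒜 hij hE (mem_trace.2 ⟨B, hB, rfl⟩)
      (fun hcr => hB' (mem_filter.2 ⟨h.right hB, hcr⟩))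
    rw [show E.erase s = A ∩ Icc 1 s from hEA] at this
    exact this.trans (card_le_card (inter_subset_inter inter_subset_left inter_subset_left))

lemma card_criticalMembers_add_le (h : IsOptimal t n k m l 𝒜 ℬ) (hp : Admissible t n k m l)
    (hs : TraceCross t s 𝒜 ℬ) (hsk : s ≤ k + l - t) (hs1 : 1 ≤ s) (hik : i ≤ k)
    {𝒲 : Finset (Finset ℕ)}
    (h𝒲 : ∀ W ∈ 𝒲, W ⊆ Icc 1 (s - 1) ∧ #W = i ∧ W ∈ trace s 𝒜) :
    #𝒲 * (n - s + 1).choose (k - i) + #(criticalMembers s i n k 𝒜) ≤ #𝒜 := by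
  have hsn : s ≤ n := hp.le_of_le hsk
  have hcard : #{A ∈ level n k | A ∩ Icc 1 (s - 1) ∈ 𝒲} = #𝒲 * (n - s + 1).choose (k - i) := by
    rw [card_filter_inter_mem (i := i) (Icc_subset_Icc_right (by omega))
      (fun W hW => ⟨(h𝒲 W hW).1, (h𝒲 W hW).2.1⟩) hik, Nat.card_Icc]
    congr 2
    omega
  have hsub : Icc 1 (s - 1) ⊆ Icc 1 s := Icc_subset_Icc_right (by omega)
  rw [← hcard, ← card_union_of_disjoint]
  · refine card_le_card (union_subset ?_ (criticalMembers_subset h hp hs))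
    intro A hA
    obtain ⟨hA, hW⟩ := mem_filter.1 hA
    exact mem_of_trace_subset h hp hs (h𝒲 _ hW).2.2 hA (inter_subset_inter_left hsub)
  · rw [disjoint_left]
    intro A hA hA'
    obtain ⟨-, hW⟩ := mem_filter.1 hA
    obtain ⟨-, -, hsA, hcA, -⟩ := mem_filter.1 hA' |>.imp id mem_critical.1
    have hlt : A ∩ Icc 1 (s - 1) ⊂ A ∩ Icc 1 s := by
      refine ⟨inter_subset_inter_left hsub, fun hsub' => ?_⟩
      have := mem_Icc.1 (mem_inter.1 (hsub' hsA)).2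
      omega
    have := card_lt_card hlt
    have := (h𝒲 _ hW).2.1
    omega

lemma subset_pred_of_notMem {W : Finset ℕ} (hW : W ⊆ Icc 1 s) (hsW : s ∉ W) :
    W ⊆ Icc 1 (s - 1) := fun x hx => by
  have h1 := mem_Icc.1 (hW hx)
  have h2 : x ≠ s := by rintro rfl; exact hsW hx
  exact mem_Icc.2 (by omega)

/-- Compressing the critical traces produces many members outside `criticalMembers`. -/
lemma card_critical_mul_le (h : IsOptimal t n k m l 𝒜 ℬ) (hp : Admissible t n k m l)
    (hs : TraceCross t s 𝒜 ℬ) (h𝒜 : IsShifted 𝒜) (hsk : s ≤ k + l - t) (hs1 : 1 ≤ s)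
    (hik : i ≤ k) :
    #(critical s i 𝒜) * (s - i) * (n - s + 1).choose (k - i) ≤
      i * (#𝒜 - #(criticalMembers s i n k 𝒜)) := by
  classical
  set 𝒲 : Finset (Finset ℕ) := {W ∈ trace s 𝒜 | W ⊆ Icc 1 (s - 1) ∧ #W = i} with h𝒲
  have hmain := card_criticalMembers_add_le (𝒲 := 𝒲) h hp hs hsk hs1 hik (fun W hW => by
    have := mem_filter.1 hW
    exact ⟨this.2.1, this.2.2, this.1⟩)
  have hdouble : #(critical s i 𝒜) * (s - i) ≤ #𝒲 * i := by
    refine card_mul_le_card_mul (fun E W => E.erase s ⊆ W) ?_ ?_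
    · intro E hE
      obtain ⟨hE, hsE, hEi, -⟩ := mem_critical.1 hE
      have hEs := subset_of_mem_trace hE
      have hc : #(Icc 1 s \ E) = s - i := by rw [card_sdiff_of_subset hEs, hEi]; simp
      rw [← hc]
      refine card_le_card_of_injOn (fun x => insert x (E.erase s)) ?_ ?_
      · intro x hx
        obtain ⟨hxs, hxE⟩ := mem_sdiff.1 (mem_coe.1 hx)
        have hx' := mem_Icc.1 hxs
        have hne : x ≠ s := by rintro rfl; exact hxE hsE
        have htr := h𝒜.trace hE hx'.1 (by omega : x < s) hsE hxE
        refine mem_coe.2 ((mem_bipartiteAbove _).2 ⟨mem_filter.2 ⟨htr, ?_, ?_⟩,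
          subset_insert _ _⟩)
        · refine subset_pred_of_notMem (subset_of_mem_trace htr) ?_
          simp [hne.symm]
        · rw [card_insert_of_notMem (fun h => hxE (mem_of_mem_erase h)), card_erase_of_mem hsE]
          have := card_pos.2 ⟨s, hsE⟩
          omega
      · intro x hx y hy hxy
        have hxE := (mem_sdiff.1 (mem_coe.1 hx)).2
        have hx' : x ∈ insert y (E.erase s) := by
          rw [← show insert x (E.erase s) = insert y (E.erase s) from hxy]
          exact mem_insert_self _ _
        rcases mem_insert.1 hx' with rfl | hx'
        · rfl
        · exact absurd (mem_of_mem_erase hx') hxE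
    · intro W hW
      obtain ⟨-, hWs, hWi⟩ := mem_filter.1 hW
      rw [← hWi]
      refine (card_le_card ?_).trans (card_image_le (f := fun x => insert s (W.erase x)))
      intro E hE
      obtain ⟨hE, hEW⟩ := (mem_bipartiteBelow _).1 hE
      obtain ⟨-, hsE, hEi, -⟩ := mem_critical.1 hE
      have hpos := card_pos.2 ⟨s, hsE⟩
      have hc : #(W \ E.erase s) = 1 := by
        rw [card_sdiff_of_subset hEW, card_erase_of_mem hsE]
        omega
      obtain ⟨x, hx⟩ := card_eq_one.1 hc
      have hxW : x ∈ W \ E.erase s := by rw [hx]; exact mem_singleton_self _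
      refine mem_image.2 ⟨x, (mem_sdiff.1 hxW).1, ?_⟩
      rw [← sdiff_singleton_eq_erase x W, ← hx, Finset.sdiff_sdiff_eq_self hEW, insert_erase hsE]
  calc _ ≤ #𝒲 * i * (n - s + 1).choose (k - i) := Nat.mul_le_mul_right _ hdouble
    _ = i * (#𝒲 * (n - s + 1).choose (k - i)) := by ring
    _ ≤ _ := Nat.mul_le_mul_left _ (by omega)

end Exchange

section Numeric

lemma false_of_exchange {P Q P' Q' X Y a b c i : ℤ} (hP : 0 ≤ P) (hQ' : 0 ≤ Q')
    (hX : 0 < X) (hY : 0 < Y) (hc : 0 < c) (ha : 0 ≤ a) (hQ : 0 < Q)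
    (h1 : P * X * b ≤ Q * (a + X) * Y) (h2 : P' * Y * a ≤ Q' * (b + Y) * X)
    (h3 : X * c * (P + Q) ≤ i * a * (P + 1))
    (key : i * (P + 1) * Q' + c * Q * Q' < c * P * P') : False := by
  have ha : 0 < a := by
    rcases ha.eq_or_lt with rfl | ha
    · have : 0 < X * c * (P + Q) := by positivity
      simp at h3
      omega
    · exact ha
  have h4 : P * P' * a ≤ Q' * (Q * a + Q * X + P * X) := by
    refine le_of_mul_le_mul_right ?_ hY
    nlinarith [mul_le_mul_of_nonneg_left h2 hP, mul_le_mul_of_nonneg_left h1 hQ']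
  have h5 : c * (P * P' * a) ≤ Q' * (c * Q * a) + Q' * (i * a * (P + 1)) := by
    nlinarith [mul_le_mul_of_nonneg_left h4 hc.le, mul_le_mul_of_nonneg_left h3 hQ']
  nlinarith [mul_lt_mul_of_pos_right key ha]

lemma key_polynomial {t c d N : ℕ} (ht : 3 ≤ t) (hd : 1 ≤ d) (hdc : d ≤ c) (hc : 2 ≤ c)
    (hN : c + 1 ≤ N) :
    ((t + d + c * (N - d)) * (N - c) : ℤ) < (t * N - t + 1 - c) * (N * (c * t - t - d) + c) := by
  obtain ⟨e, rfl⟩ := Nat.exists_eq_add_of_le hN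
  obtain ⟨u, rfl⟩ := Nat.exists_eq_add_of_le ht
  rcases hd.eq_or_lt with rfl | hd
  · obtain ⟨f, rfl⟩ := Nat.exists_eq_add_of_le hc
    rw [← sub_pos]
    push_cast
    ring_nf
    positivity
  · obtain ⟨f, rfl⟩ := Nat.exists_eq_add_of_le hd
    obtain ⟨g, rfl⟩ := Nat.exists_eq_add_of_le hdc
    rw [← sub_pos]
    push_cast
    ring_nf
    positivity

lemma key_inequality {t c d N P Q P' Q' : ℕ} (ht : 3 ≤ t) (hd : 1 ≤ d) (hdc : d ≤ c) (hc : 2 ≤ c)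
    (hQ1 : 1 ≤ Q') (hQ : Q + d ≤ N) (hQ' : Q' + c ≤ N) (hP : t * N + 1 ≤ P + t + c)
    (hP' : t * N + 1 ≤ P' + t + d) :
    ((t + d) * (P + 1) * Q' + c * Q * Q' : ℤ) < c * P * P' := by
  have h0 := key_polynomial ht hd hdc hc (by omega : c + 1 ≤ N)
  zify at *
  have hg : (0 : ℤ) ≤ c * t - t - d := by nlinarith
  have hG : (N * (c * t - t - d) + c : ℤ) ≤ c * P' - (t + d) * Q' := by nlinarith
  have hP0 : (0 : ℤ) ≤ t * N - t + 1 - c := by nlinarith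
  have h1 : (t * N - t + 1 - c : ℤ) * (N * (c * t - t - d) + c) ≤
      P * (c * P' - (t + d) * Q') :=
    mul_le_mul (by linarith) hG (by positivity) (by positivity)
  have h2 : ((t + d + c * Q) * Q' : ℤ) ≤ (t + d + c * (N - d)) * (N - c) :=
    mul_le_mul (by nlinarith) (by linarith) (by positivity) (by nlinarith)
  nlinarith

lemma balanced_inequality {M P Q P' Q' : ℕ} (hM : 1 ≤ M) (hP : 3 * M ≤ P) (hP' : 3 * M ≤ P')
    (hQ : Q ≤ M) (hQ' : Q' ≤ M) : (P + 1) * Q' + Q * Q' < P * P' := by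
  have h1 := Nat.mul_le_mul_left (P + 1) hQ'
  have h2 := Nat.mul_le_mul hQ hQ'
  have h3 := Nat.mul_le_mul_left P hP'
  have h4 := Nat.mul_le_mul_right M hP
  have h5 := Nat.mul_le_mul_right M hM
  nlinarith

end Numeric

section Shifted

variable {t n k m l s i j : ℕ} {𝒜 ℬ : Finset (Finset ℕ)} {A B E F : Finset ℕ}

/-- The inequality of `exchange_le`, with the binomial coefficients eliminated. -/
lemma exchange_mul_le (h : IsOptimal t n k m l 𝒜 ℬ) (hp : Admissible t n k m l)
    (hs : TraceCross t s 𝒜 ℬ) (h𝒜 : IsShifted 𝒜) (hsk : s ≤ k + l - t) (hij : i + j = s + t)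
    (hi : 1 ≤ i) (hik : i ≤ k) (hjl : j ≤ l) :
    (n - s - (k - i)) * #(criticalMembers s i n k 𝒜) * (#ℬ - #(criticalMembers s j m l ℬ)) ≤
      (k - i + 1) * #𝒜 * #(criticalMembers s j m l ℬ) := by
  have hsn : s ≤ n := hp.le_of_le hsk
  have hsm : s ≤ m := hp.symm.le_of_le (by omega)
  have hle := exchange_le h hp hs h𝒜 hsk hij hi hik hjl
  have hY := card_le_card (criticalMembers_subset (i := j) h.symm hp.symm hs.symm)
  rw [← card_criticalMembers hsm hjl] at hle
  set Y := #(criticalMembers s j m l ℬ)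
  obtain ⟨b, hb⟩ := Nat.exists_eq_add_of_le hY
  have hch := Nat.choose_succ_right_eq (n - s) (k - i)
  rw [card_criticalMembers hsn hik]
  rw [hb, Nat.add_sub_cancel_left] at hle ⊢
  have h1 : #(critical s i 𝒜) * (n - s).choose (k - i + 1) * b ≤ #𝒜 * Y := by nlinarith
  calc _ = #(critical s i 𝒜) * b * ((n - s).choose (k - i) * (n - s - (k - i))) := by ring
    _ = (k - i + 1) * (#(critical s i 𝒜) * (n - s).choose (k - i + 1) * b) := by
      rw [← hch]; ring
    _ ≤ (k - i + 1) * (#𝒜 * Y) := Nat.mul_le_mul_left _ h1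
    _ = _ := by ring

lemma choose_succ_mul {a b : ℕ} (hba : b ≤ a) :
    a.choose b * (a - b + (b + 1)) = (a + 1).choose b * (a - b + 1) := by
  have := Nat.choose_mul_succ_eq a b
  rwa [show a - b + (b + 1) = a + 1 by omega, show a - b + 1 = a + 1 - b by omega]

lemma Admissible.trace_le (hp : Admissible t n k m l) (hsk : s ≤ k + l - t) (hti : t ≤ i) :
    k - i ≤ n - s := by
  have := hp.le_n
  have := hp.le_left
  have := hp.le_right
  omega

/-- The inequality of `card_critical_mul_le`, with the binomial coefficients eliminated. -/
lemma criticalMembers_mul_le (h : IsOptimal t n k m l 𝒜 ℬ) (hp : Admissible t n k m l)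
    (hs : TraceCross t s 𝒜 ℬ) (h𝒜 : IsShifted 𝒜) (hsk : s ≤ k + l - t) (hs1 : 1 ≤ s)
    (hti : t ≤ i) (hik : i ≤ k) :
    #(criticalMembers s i n k 𝒜) * (s - i) * (n - s - (k - i) + (k - i + 1)) ≤
      i * (#𝒜 - #(criticalMembers s i n k 𝒜)) * (n - s - (k - i) + 1) := by
  have hle := card_critical_mul_le h hp hs h𝒜 hsk hs1 hik
  have hch := choose_succ_mul (hp.trace_le hsk hti)
  set a := #𝒜 - #(criticalMembers s i n k 𝒜)
  rw [card_criticalMembers (hp.le_of_le hsk) hik]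
  calc _ = #(critical s i 𝒜) * (s - i) *
        ((n - s).choose (k - i) * (n - s - (k - i) + (k - i + 1))) := by ring
    _ = #(critical s i 𝒜) * (s - i) * (n - s + 1).choose (k - i) * (n - s - (k - i) + 1) := by
      rw [hch]; ring
    _ ≤ _ := Nat.mul_le_mul_right _ hle

lemma card_criticalMembers_pos (hp : Admissible t n k m l) (hsk : s ≤ k + l - t) (hti : t ≤ i)
    (hik : i ≤ k) (hne : (critical s i 𝒜).Nonempty) : 0 < #(criticalMembers s i n k 𝒜) := by
  rw [card_criticalMembers (hp.le_of_le hsk) hik]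
  exact Nat.mul_pos (card_pos.2 hne) (Nat.choose_pos (hp.trace_le hsk hti))

/-- If `{1, …, s}` is critical, then it is the only trace. -/
lemma subset_criticalMembers (h : IsOptimal t n k m l 𝒜 ℬ) (hp : Admissible t n k m l)
    (hs : TraceCross t s 𝒜 ℬ) (h𝒜 : IsShifted 𝒜) (hsk : s ≤ k + l - t)
    (hne : (critical s s 𝒜).Nonempty) : 𝒜 ⊆ criticalMembers s s n k 𝒜 := by
  intro A hA
  obtain ⟨E, hE⟩ := hne
  obtain ⟨hEt, hsE, hEs, hE'⟩ := mem_critical.1 hE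
  obtain rfl : E = Icc 1 s :=
    eq_of_subset_of_card_le (subset_of_mem_trace hEt) (by simp [hEs])
  have hsk' := (card_mem_trace h hp hs hEt).2
  rw [hEs] at hsk'
  refine mem_filter.2 ⟨h.left hA, ?_⟩
  suffices A ∩ Icc 1 s = Icc 1 s by rwa [this]
  refine subset_antisymm inter_subset_right fun y hy => mem_inter.2 ⟨?_, hy⟩
  by_contra hyA
  have hyt : (Icc 1 s).erase y ∈ trace s 𝒜 := by
    refine trace_upward h hp hs hsk (mem_trace.2 ⟨A, hA, rfl⟩) ?_ (erase_subset _ _) ?_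
    · intro z hz
      exact mem_erase.2 ⟨by rintro rfl; exact hyA (mem_inter.1 hz).1, (mem_inter.1 hz).2⟩
    · exact (card_le_card (erase_subset _ _)).trans (by simpa using hsk')
  rcases eq_or_ne y s with rfl | hys
  · exact hE' hyt
  · have hy' := mem_Icc.1 hy
    have := h𝒜.trace hyt hy'.1 (by omega : y < s) (mem_erase.2 ⟨hys.symm, hsE⟩) (notMem_erase _ _)
    rw [erase_right_comm, insert_erase (mem_erase.2 ⟨hys, hy⟩)] at this
    exact hE' this

lemma false_of_critical_full (h : IsOptimal t n k m l 𝒜 ℬ) (hp : Admissible t n k m l)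
    (hs : TraceCross t s 𝒜 ℬ) (h𝒜 : IsShifted 𝒜) (hℬ : IsShifted ℬ) (hsk : s ≤ k + l - t)
    (hts : t < s) (hne : (critical s t 𝒜).Nonempty) (hne' : (critical s s ℬ).Nonempty) :
    False := by
  have hsl : s ≤ l := by
    obtain ⟨F, hF⟩ := hne'
    have hF := mem_critical.1 hF
    rw [← hF.2.2.1]
    exact (card_mem_trace h.symm hp.symm hs.symm hF.1).2
  have hY := subset_criticalMembers h.symm hp.symm hs.symm hℬ (by omega) hne'
  have hYeq := subset_antisymm (criticalMembers_subset h.symm hp.symm hs.symm) hY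
  have h1 := exchange_mul_le h.symm hp.symm hs.symm hℬ (by omega : s ≤ l + k - t)
    (rfl : s + t = s + t) (by omega) hsl hp.le_left
  have h2 := criticalMembers_mul_le h hp hs h𝒜 hsk (by omega) le_rfl hp.le_left
  have hX := card_criticalMembers_pos hp hsk le_rfl hp.le_left hne
  have hB := card_pos.2 (h.symm.left_nonempty hp.symm)
  rw [hYeq] at h1
  set X := #(criticalMembers s t n k 𝒜)
  set a := #𝒜 - X
  have h3 : (m - s - (l - s)) * a ≤ (l - s + 1) * X :=
    le_of_mul_le_mul_right (by linarith) hB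
  have h4 : X * (s - t) ≤ t * a := by
    refine le_of_mul_le_mul_right (h2.trans' ?_) (by positivity : 0 < n - s - (k - t) + 1)
    exact Nat.mul_le_mul_left _ (by omega)
  have h5 : (m - s - (l - s)) * (s - t) ≤ t * (l - s + 1) := by
    refine le_of_mul_le_mul_right ?_ hX
    nlinarith
  have h6 := hp.right_right
  have h7 := hp.le_right
  have h8 := hp.symm.le_n
  have h9 : t * (l - s + 1) ≤ t * (l - t) := Nat.mul_le_mul_left _ (by omega)
  have h10 : m - s - (l - s) ≤ (m - s - (l - s)) * (s - t) := Nat.le_mul_of_pos_right _ (by omega)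
  have h11 : (t + 1) * (l - t + 1) = t * (l - t) + (l - t) + t + 1 := by ring
  omega

lemma false_of_critical_large {c d : ℕ} (h : IsOptimal t n k m l 𝒜 ℬ)
    (hp : Admissible t n k m l) (hs : TraceCross t s 𝒜 ℬ) (h𝒜 : IsShifted 𝒜) (hℬ : IsShifted ℬ)
    (hsk : s ≤ k + l - t) (hsc : s = t + c + d) (hd : 1 ≤ d) (hdc : d ≤ c) (hc : 2 ≤ c)
    (hne : (critical s (t + d) 𝒜).Nonempty) (hne' : (critical s (t + c) ℬ).Nonempty) :
    False := by
  have hdk : t + d ≤ k := by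
    obtain ⟨E, hE⟩ := hne
    have hE := mem_critical.1 hE
    rw [← hE.2.2.1]
    exact (card_mem_trace h hp hs hE.1).2
  have hcl : t + c ≤ l := by
    obtain ⟨F, hF⟩ := hne'
    have hF := mem_critical.1 hF
    rw [← hF.2.2.1]
    exact (card_mem_trace h.symm hp.symm hs.symm hF.1).2
  have h1 := exchange_mul_le h hp hs h𝒜 hsk (by omega : (t + d) + (t + c) = s + t) (by omega)
    hdk hcl
  have h2 := exchange_mul_le h.symm hp.symm hs.symm hℬ (by omega : s ≤ l + k - t)
    (by omega : (t + c) + (t + d) = s + t) (by omega) hcl hdk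
  have h3 := criticalMembers_mul_le h hp hs h𝒜 hsk (by omega) (by omega) hdk
  have hX := card_criticalMembers_pos hp hsk (by omega) hdk hne
  have hY := card_criticalMembers_pos hp.symm (by omega : s ≤ l + k - t) (by omega) hcl hne'
  have hXA := card_le_card (criticalMembers_subset (i := t + d) h hp hs)
  have hYB := card_le_card (criticalMembers_subset (i := t + c) h.symm hp.symm hs.symm)
  obtain ⟨a, ha⟩ := Nat.exists_eq_add_of_le hXA
  obtain ⟨b, hb⟩ := Nat.exists_eq_add_of_le hYB
  have h4 := hp.le_n
  have h5 := hp.symm.le_n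
  rw [ha] at h1 h2 h3
  rw [hb] at h1 h2
  rw [Nat.add_sub_cancel_left] at h1 h2 h3
  rw [show s - (t + d) = c by omega] at h3
  generalize #(criticalMembers s (t + d) n k 𝒜) = X at h1 h2 h3 hX
  generalize #(criticalMembers s (t + c) m l ℬ) = Y at h1 h2 hY
  have key : ((t + d) * ((n - s - (k - (t + d)) : ℕ) + 1) * (l - (t + c) + 1 : ℕ) +
      c * (k - (t + d) + 1 : ℕ) * (l - (t + c) + 1 : ℕ) : ℤ) <
      c * (n - s - (k - (t + d)) : ℕ) * (m - s - (l - (t + c)) : ℕ) := by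
    have h6 : (t + 1) * (max (k - t) (l - t) + 1) ≤ n := by
      rcases max_choice (k - t) (l - t) with h | h <;> rw [h]
      exacts [hp.left_left, hp.left_right]
    have h7 : (t + 1) * (max (k - t) (l - t) + 1) ≤ m := by
      rcases max_choice (k - t) (l - t) with h | h <;> rw [h]
      exacts [hp.right_left, hp.right_right]
    have h8 : (t + 1) * (max (k - t) (l - t) + 1) =
      t * (max (k - t) (l - t) + 1) + (max (k - t) (l - t) + 1) := by ring
    have h9 := le_max_left (k - t) (l - t)
    have h10 := le_max_right (k - t) (l - t)
    exact key_inequality (N := max (k - t) (l - t) + 1) hp.three_le hd hdc hc (by omega)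
      (by omega) (by omega) (by omega) (by omega)
  zify at h1 h2 h3 hX hY
  push_cast at h1 h2 h3 key
  exact false_of_exchange (a := a) (b := b) (by positivity) (by positivity) hX hY (by omega)
    (by positivity) (by positivity) (by linarith) (by linarith) (by linarith) key

end Shifted

section Balanced

variable {t n k m l : ℕ} {𝒜 ℬ : Finset (Finset ℕ)} {A B E F : Finset ℕ}

lemma eq_erase_of_mem_critical (hE : E ∈ critical (t + 2) (t + 1) 𝒜) :
    ∃ z ∈ Icc 1 (t + 1), E = (Icc 1 (t + 2)).erase z := by
  obtain ⟨hEt, hsE, hEi, -⟩ := mem_critical.1 hE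
  have hEs := subset_of_mem_trace hEt
  have hc : #(Icc 1 (t + 2) \ E) = 1 := by
    rw [card_sdiff_of_subset hEs, hEi, Nat.card_Icc]; omega
  obtain ⟨z, hz⟩ := card_eq_one.1 hc
  have hzm : z ∈ Icc 1 (t + 2) \ E := by rw [hz]; exact mem_singleton_self z
  obtain ⟨hz1, hz2⟩ := mem_sdiff.1 hzm
  have hz1 := mem_Icc.1 hz1
  have hne : z ≠ t + 2 := by rintro rfl; exact hz2 hsE
  refine ⟨z, mem_Icc.2 (by omega), ?_⟩
  rw [← sdiff_singleton_eq_erase, ← hz, Finset.sdiff_sdiff_eq_self hEs]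

lemma critical_subset_image :
    critical (t + 2) (t + 1) 𝒜 ⊆ (Icc 1 (t + 1)).image fun z => (Icc 1 (t + 2)).erase z := by
  intro E hE
  obtain ⟨z, hz, rfl⟩ := eq_erase_of_mem_critical hE
  exact mem_image.2 ⟨z, hz, rfl⟩

lemma card_critical_le : #(critical (t + 2) (t + 1) 𝒜) ≤ t + 1 :=
  (card_le_card critical_subset_image).trans (card_image_le.trans (by simp))

lemma le_of_mem_critical (h : IsOptimal t n k m l 𝒜 ℬ) (hp : Admissible t n k m l)
    (hs : TraceCross t (t + 2) 𝒜 ℬ) (hE : E ∈ critical (t + 2) (t + 1) 𝒜) : t + 1 ≤ k := by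
  have hE := mem_critical.1 hE
  rw [← hE.2.2.1]
  exact (card_mem_trace h hp hs hE.1).2

lemma two_le_card_critical (h : IsOptimal t n k m l 𝒜 ℬ) (hp : Admissible t n k m l)
    (hs : TraceCross t (t + 2) 𝒜 ℬ) (h𝒜 : IsShifted 𝒜) (hℬ : IsShifted ℬ)
    (hne : (critical (t + 2) (t + 1) 𝒜).Nonempty) (hne' : (critical (t + 2) (t + 1) ℬ).Nonempty) :
    2 ≤ #(critical (t + 2) (t + 1) 𝒜) := by
  have hk : t + 1 ≤ k := le_of_mem_critical h hp hs hne.choose_spec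
  have hl : t + 1 ≤ l := le_of_mem_critical h.symm hp.symm hs.symm hne'.choose_spec
  have hsk : t + 2 ≤ k + l - t := by omega
  have hsk' : t + 2 ≤ l + k - t := by omega
  by_contra! hlt
  have hone : #(critical (t + 2) (t + 1) 𝒜) = 1 := by
    have := card_pos.2 hne
    omega
  have htr : Icc 1 (t + 1) ∈ trace (t + 2) 𝒜 := by
    obtain ⟨E, hE⟩ := hne
    obtain ⟨z, hz, rfl⟩ := eq_erase_of_mem_critical hE
    have hz := mem_Icc.1 hz
    have := h𝒜.trace (mem_critical.1 hE).1 hz.1 (by omega : z < t + 2) (mem_critical.1 hE).2.1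
      (notMem_erase _ _)
    rw [erase_right_comm, insert_erase (mem_erase.2 ⟨by omega, mem_Icc.2 (by omega)⟩)] at this
    convert this using 1
    ext x
    simp only [mem_Icc, mem_erase]
    omega
  have h3 := card_criticalMembers_add_le (i := t + 1) (𝒲 := {Icc 1 (t + 1)}) h hp hs hsk
    (by omega) hk (fun W hW => by
      rw [mem_singleton.1 hW]
      exact ⟨subset_rfl, by simp, htr⟩)
  have h1 := exchange_mul_le h hp hs h𝒜 hsk (by omega : (t + 1) + (t + 1) = t + 2 + t) (by omega)
    hk hl
  have h2 := exchange_mul_le h.symm hp.symm hs.symm hℬ hsk'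
    (by omega : (t + 1) + (t + 1) = t + 2 + t) (by omega) hl hk
  have hX := card_criticalMembers_pos hp hsk (by omega) hk hne
  have hY := card_criticalMembers_pos hp.symm hsk' (by omega) hl hne'
  have hXA := card_le_card (criticalMembers_subset (i := t + 1) h hp hs)
  have hYB := card_le_card (criticalMembers_subset (i := t + 1) h.symm hp.symm hs.symm)
  obtain ⟨a, ha⟩ := Nat.exists_eq_add_of_le hXA
  obtain ⟨b, hb⟩ := Nat.exists_eq_add_of_le hYB
  rw [ha] at h1 h2 h3
  rw [hb] at h1 h2
  rw [Nat.add_sub_cancel_left] at h1 h2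
  rw [card_singleton, one_mul] at h3
  have hch := choose_succ_mul (hp.trace_le hsk (by omega : t ≤ t + 1))
  have hXeq := card_criticalMembers (𝒜 := 𝒜) (hp.le_of_le hsk) hk
  rw [hone, one_mul] at hXeq
  rw [← hXeq] at hch
  have hn := hp.left_left
  have hn' := hp.left_right
  have hm := hp.right_left
  have hm' := hp.right_right
  have h4 := hp.le_n
  have h5 := hp.symm.le_n
  have ht := hp.three_le
  generalize #(criticalMembers (t + 2) (t + 1) n k 𝒜) = X at h1 h2 h3 hX hch
  generalize #(criticalMembers (t + 2) (t + 1) m l ℬ) = Y at h1 h2 hY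
  have h6 : X * (n - (t + 2) - (k - (t + 1)) + (k - (t + 1) + 1)) ≤
      a * (n - (t + 2) - (k - (t + 1)) + 1) := by
    rw [hch]; exact Nat.mul_le_mul_right _ (by omega)
  have key : ((n - (t + 2) - (k - (t + 1)) : ℕ) + 1 : ℤ) * (l - (t + 1) + 1 : ℕ) +
      (k - (t + 1) + 1 : ℕ) * (l - (t + 1) + 1 : ℕ) <
      (n - (t + 2) - (k - (t + 1)) : ℕ) * (m - (t + 2) - (l - (t + 1)) : ℕ) := by
    set M := max (k - t) (l - t) with hM
    have h7 : (t + 1) * (M + 1) ≤ n := by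
      rcases max_choice (k - t) (l - t) with h | h <;> rw [hM, h] <;> assumption
    have h8 : (t + 1) * (M + 1) ≤ m := by
      rcases max_choice (k - t) (l - t) with h | h <;> rw [hM, h] <;> assumption
    have h9 := le_max_left (k - t) (l - t)
    have h10 := le_max_right (k - t) (l - t)
    have h11 : (t + 1) * (M + 1) = t * M + M + t + 1 := by ring
    have h12 : 3 * M ≤ t * M := Nat.mul_le_mul_right _ ht
    have hP : 3 * M ≤ n - (t + 2) - (k - (t + 1)) := by omega
    have hP' : 3 * M ≤ m - (t + 2) - (l - (t + 1)) := by omega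
    have hQ : k - (t + 1) + 1 ≤ M := by omega
    have hQ' : l - (t + 1) + 1 ≤ M := by omega
    exact_mod_cast balanced_inequality (by omega : 1 ≤ M) hP hP' hQ hQ'
  zify at h1 h2 h6 hX hY
  push_cast at h1 h2 h6 key
  exact false_of_exchange (P := (n - (t + 2) - (k - (t + 1)) : ℕ)) (Q := (k - (t + 1) : ℕ) + 1)
    (P' := (m - (t + 2) - (l - (t + 1)) : ℕ)) (Q' := (l - (t + 1) : ℕ) + 1) (X := X) (Y := Y)
    (a := a) (b := b) (c := 1) (i := 1) (by positivity) (by positivity) hX hY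
    one_pos (by positivity) (by positivity) (by linarith) (by linarith) (by linarith)
    (by linarith)

lemma erase_mem_critical (hs : TraceCross t (t + 2) 𝒜 ℬ) (h𝒜 : IsShifted 𝒜)
    (hne : (critical (t + 2) (t + 1) 𝒜).Nonempty)
    (hℬ : 2 ≤ #(critical (t + 2) (t + 1) ℬ)) :
    (Icc 1 (t + 2)).erase (t + 1) ∈ critical (t + 2) (t + 1) 𝒜 := by
  obtain ⟨E, hE⟩ := hne
  obtain ⟨z, hz, rfl⟩ := eq_erase_of_mem_critical hE
  obtain ⟨hEt, hsE, hEi, -⟩ := mem_critical.1 hE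
  rcases eq_or_ne z (t + 1) with rfl | hzt
  · exact hE
  have hz := mem_Icc.1 hz
  have htr := h𝒜.trace hEt hz.1 (by omega : z < t + 1)
    (mem_erase.2 ⟨hzt.symm, mem_Icc.2 (by omega)⟩) (notMem_erase _ _)
  rw [erase_right_comm, insert_erase (mem_erase.2 ⟨hzt, mem_Icc.2 (by omega)⟩)] at htr
  refine mem_critical.2 ⟨htr, mem_erase.2 ⟨by omega, mem_Icc.2 (by omega)⟩, ?_, fun htr' => ?_⟩
  · rw [card_erase_of_mem (mem_Icc.2 (by omega))]; simp
  · obtain ⟨F, hF, hFne⟩ := exists_mem_ne hℬ ((Icc 1 (t + 2)).erase (t + 1))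
    obtain ⟨w, hw, rfl⟩ := eq_erase_of_mem_critical hF
    have hwt : w ≠ t + 1 := by rintro rfl; exact hFne rfl
    have hw := mem_Icc.1 hw
    have h1 := hs _ htr' _ (mem_critical.1 hF).1
    have h2 : ((Icc 1 (t + 2)).erase (t + 1)).erase (t + 2) ∩ (Icc 1 (t + 2)).erase w =
        (Icc 1 t).erase w := by
      ext x
      simp only [mem_inter, mem_erase, mem_Icc]
      omega
    rw [h2, card_erase_of_mem (mem_Icc.2 (by omega)), Nat.card_Icc] at h1
    omega

/-- Replacing the critical members on both sides by the sets meeting `{1, …, t + 1}` in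
`{1, …, t}`. -/
lemma balanced_exchange_le (h : IsOptimal t n k m l 𝒜 ℬ) (hp : Admissible t n k m l)
    (hs : TraceCross t (t + 2) 𝒜 ℬ) (h𝒜 : IsShifted 𝒜) (hℬ : IsShifted ℬ)
    (hE : (Icc 1 (t + 2)).erase (t + 1) ∈ critical (t + 2) (t + 1) 𝒜)
    (hF : (Icc 1 (t + 2)).erase (t + 1) ∈ critical (t + 2) (t + 1) ℬ) :
    (#𝒜 - #(criticalMembers (t + 2) (t + 1) n k 𝒜) + (n - (t + 1)).choose (k - t)) *
      (#ℬ - #(criticalMembers (t + 2) (t + 1) m l ℬ) + (m - (t + 1)).choose (l - t)) ≤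
      #𝒜 * #ℬ := by
  have hEE : ((Icc 1 (t + 2)).erase (t + 1)).erase (t + 2) = Icc 1 t := by
    ext x
    simp only [mem_erase, mem_Icc]
    omega
  have aux : ∀ {n k m l : ℕ} {𝒜 ℬ : Finset (Finset ℕ)}, IsOptimal t n k m l 𝒜 ℬ →
      Admissible t n k m l → TraceCross t (t + 2) 𝒜 ℬ → IsShifted 𝒜 →
      (Icc 1 (t + 2)).erase (t + 1) ∈ critical (t + 2) (t + 1) 𝒜 →
      #(𝒜 \ criticalMembers (t + 2) (t + 1) n k 𝒜 ∪ {A ∈ level n k | A ∩ Icc 1 (t + 1) = Icc 1 t})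
        = #𝒜 - #(criticalMembers (t + 2) (t + 1) n k 𝒜) + (n - (t + 1)).choose (k - t) ∧
      ∀ A ∈ {A ∈ level n k | A ∩ Icc 1 (t + 1) = Icc 1 t},
        ∀ B ∈ ℬ \ criticalMembers (t + 2) (t + 1) m l ℬ, t ≤ #(A ∩ B) := by
    intro n k m l 𝒜 ℬ h hp hs h𝒜 hE
    constructor
    · have h4 := hp.le_n
      have h5 := le_of_mem_critical h hp hs hE
      rw [card_union_of_disjoint, card_sdiff_of_subset (criticalMembers_subset h hp hs),
        card_filter_inter_eq (Icc_subset_Icc_right (by omega)) (Icc_subset_Icc_right (by omega))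
        (by simp; omega), Nat.card_Icc, Nat.card_Icc]
      · simp
      rw [disjoint_left]
      intro A hA hA'
      obtain ⟨hA, hAc⟩ := mem_sdiff.1 hA
      have hA' := (mem_filter.1 hA').2
      by_cases hsA : t + 2 ∈ A
      · have : A ∩ Icc 1 (t + 2) = (Icc 1 (t + 2)).erase (t + 1) := by
          ext x
          have := congrArg (x ∈ ·) hA'
          simp only [mem_inter, mem_Icc, eq_iff_iff, mem_erase] at this ⊢
          rcases eq_or_ne x (t + 2) with rfl | hx
          · simp [hsA]
          · constructor
            · intro h; have := this.1 ⟨h.1, by omega⟩; omega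
            · intro h; have := this.2 (by omega); exact ⟨this.1, by omega⟩
        exact hAc (mem_filter.2 ⟨h.left hA, by rwa [this]⟩)
      · have : A ∩ Icc 1 (t + 2) = Icc 1 t := by
          rw [← hA']
          ext x
          simp only [mem_inter, mem_Icc, and_congr_right_iff]
          intro hx
          have : x ≠ t + 2 := by rintro rfl; exact hsA hx
          omega
        refine (mem_critical.1 hE).2.2.2 ?_
        rw [hEE, ← this]
        exact mem_trace.2 ⟨A, hA, rfl⟩
    · intro A hA B hB
      obtain ⟨hB, hBc⟩ := mem_sdiff.1 hB
      have := le_card_erase_inter hs h𝒜 (by omega : (t + 1) + (t + 1) = t + 2 + t) hE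
        (mem_trace.2 ⟨B, hB, rfl⟩) (fun hcr => hBc (mem_filter.2 ⟨h.right hB, hcr⟩))
      rw [hEE, ← (mem_filter.1 hA).2] at this
      exact this.trans (card_le_card (inter_subset_inter inter_subset_left inter_subset_left))
  obtain ⟨h1, h2⟩ := aux h hp hs h𝒜 hE
  obtain ⟨h3, h4⟩ := aux h.symm hp.symm hs.symm hℬ hF
  rw [← h1, ← h3]
  refine h.le _ _ ⟨union_subset (sdiff_subset.trans h.left) (filter_subset _ _),
    union_subset (sdiff_subset.trans h.right) (filter_subset _ _), ?_⟩
  intro A hA B hB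
  rcases mem_union.1 hA with hA | hA <;> rcases mem_union.1 hB with hB | hB
  · exact h.cross A (mem_sdiff.1 hA).1 B (mem_sdiff.1 hB).1
  · rw [inter_comm]; exact h4 B hB A hA
  · exact h2 A hA B hB
  · have hA := (mem_filter.1 hA).2
    have hB := (mem_filter.1 hB).2
    have : Icc 1 t ⊆ A ∩ B :=
      subset_inter (hA ▸ inter_subset_left) (hB ▸ inter_subset_left)
    simpa using card_le_card this

lemma choose_le_choose {x P Q w C : ℕ} (hQ : 0 < Q) (hw : 0 < w) (hx : x ≤ t + 1)
    (hP : (t + 1) * Q ≤ P) (hC : P * w = C * Q) :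
    x * w ≤ C ∧ (C = x * w → x = t + 1 ∧ P = (t + 1) * Q) := by
  have h1 : x * Q ≤ (t + 1) * Q := Nat.mul_le_mul_right _ hx
  refine ⟨?_, fun h => ?_⟩
  · refine le_of_mul_le_mul_right ?_ hQ
    rw [← hC, mul_right_comm]
    exact Nat.mul_le_mul_right _ (h1.trans hP)
  · rw [h, mul_right_comm] at hC
    have h2 := Nat.eq_of_mul_eq_mul_right hw hC
    exact ⟨Nat.eq_of_mul_eq_mul_right hQ (by omega), by omega⟩

lemma balanced_equality (h : IsOptimal t n k m l 𝒜 ℬ) (hp : Admissible t n k m l)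
    (hs : TraceCross t (t + 2) 𝒜 ℬ) (h𝒜 : IsShifted 𝒜) (hℬ : IsShifted ℬ)
    (hne : (critical (t + 2) (t + 1) 𝒜).Nonempty) (hne' : (critical (t + 2) (t + 1) ℬ).Nonempty) :
    #(critical (t + 2) (t + 1) 𝒜) = t + 1 ∧ #(critical (t + 2) (t + 1) ℬ) = t + 1 ∧
      n = (t + 1) * (k - t + 1) ∧ m = (t + 1) * (l - t + 1) := by
  have hk : t + 1 ≤ k := le_of_mem_critical h hp hs hne.choose_spec
  have hl : t + 1 ≤ l := le_of_mem_critical h.symm hp.symm hs.symm hne'.choose_spec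
  have h1 := balanced_exchange_le h hp hs h𝒜 hℬ
    (erase_mem_critical hs h𝒜 hne (two_le_card_critical h.symm hp.symm hs.symm hℬ h𝒜 hne' hne))
    (erase_mem_critical hs.symm hℬ hne' (two_le_card_critical h hp hs h𝒜 hℬ hne hne'))
  have aux : ∀ {n k m l : ℕ} {𝒜 ℬ : Finset (Finset ℕ)}, IsOptimal t n k m l 𝒜 ℬ →
      Admissible t n k m l → TraceCross t (t + 2) 𝒜 ℬ → t + 1 ≤ k → t + 1 ≤ l →
      #(criticalMembers (t + 2) (t + 1) n k 𝒜) ≤ (n - (t + 1)).choose (k - t) ∧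
      ((n - (t + 1)).choose (k - t) = #(criticalMembers (t + 2) (t + 1) n k 𝒜) →
        #(critical (t + 2) (t + 1) 𝒜) = t + 1 ∧ n = (t + 1) * (k - t + 1)) := by
    intro n k m l 𝒜 ℬ h hp hs hk hl
    have h2 := hp.left_left
    have h3 := hp.le_n
    have h4 : (t + 1) * (k - t + 1) = (t + 1) * (k - t) + (t + 1) := by ring
    rw [card_criticalMembers (hp.le_of_le (by omega)) hk]
    have h5 := Nat.add_one_mul_choose_eq (n - (t + 2)) (k - (t + 1))
    rw [show n - (t + 2) + 1 = n - (t + 1) by omega, show k - (t + 1) + 1 = k - t by omega] at h5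
    have h6 := choose_le_choose (by omega : 0 < k - t)
      (Nat.choose_pos (by omega : k - (t + 1) ≤ n - (t + 2))) (card_critical_le (t := t) (𝒜 := 𝒜))
      (by omega : (t + 1) * (k - t) ≤ n - (t + 1)) h5
    refine ⟨h6.1, fun h => ?_⟩
    obtain ⟨h7, h8⟩ := h6.2 h
    exact ⟨h7, by omega⟩
  obtain ⟨h2, h3⟩ := aux h hp hs hk hl
  obtain ⟨h4, h5⟩ := aux h.symm hp.symm hs.symm hl hk
  have h6 := card_le_card (criticalMembers_subset (i := t + 1) h hp hs)
  have h7 := card_le_card (criticalMembers_subset (i := t + 1) h.symm hp.symm hs.symm)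
  have h8 := card_pos.2 (h.left_nonempty hp)
  have h9 := card_pos.2 (h.symm.left_nonempty hp.symm)
  obtain ⟨p, hpe⟩ := Nat.exists_eq_add_of_le h2
  obtain ⟨q, hqe⟩ := Nat.exists_eq_add_of_le h4
  rw [hpe, hqe, ← add_assoc, ← add_assoc, Nat.sub_add_cancel h6, Nat.sub_add_cancel h7] at h1
  have hp0 : p = 0 := by nlinarith [Nat.zero_le (p * q), Nat.zero_le (q * #𝒜)]
  have hq0 : q = 0 := by nlinarith [Nat.zero_le (p * q), Nat.zero_le (p * #ℬ)]
  obtain ⟨h10, h11⟩ := h3 (by omega)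
  obtain ⟨h12, h13⟩ := h5 (by omega)
  exact ⟨h10, h12, h11, h13⟩

lemma subset_frankl (h : IsOptimal t n k m l 𝒜 ℬ) (hp : Admissible t n k m l)
    (hs : TraceCross t (t + 2) 𝒜 ℬ) (hℬ : #(critical (t + 2) (t + 1) ℬ) = t + 1) :
    𝒜 ⊆ frankl n k (t + 1) (Icc 1 (t + 2)) := by
  have himage := eq_of_subset_of_card_le (critical_subset_image (t := t) (𝒜 := ℬ))
    (card_image_le.trans (by simp [hℬ]))
  intro A hA
  refine mem_filter.2 ⟨h.left hA, ?_⟩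
  have htr : A ∩ Icc 1 (t + 2) ∈ trace (t + 2) 𝒜 := mem_trace.2 ⟨A, hA, rfl⟩
  have h1 := (card_mem_trace h hp hs htr).1
  have h2 := hp.three_le
  obtain ⟨z, hz, hzt⟩ := exists_mem_ne (by omega : 1 < #(A ∩ Icc 1 (t + 2))) (t + 2)
  have hzI := mem_Icc.1 (mem_inter.1 hz).2
  have hF : (Icc 1 (t + 2)).erase z ∈ critical (t + 2) (t + 1) ℬ := by
    rw [himage]
    exact mem_image.2 ⟨z, mem_Icc.2 (by omega), rfl⟩
  have h3 := hs _ htr _ (mem_critical.1 hF).1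
  rw [inter_erase, inter_assoc, inter_self, card_erase_of_mem hz] at h3
  omega

/-- The admissible sizes `t + 2 * r` of the sets `T` in `frankl _ _ (t + r) T`. -/
def IsExtremalIndex (r t n k m l : ℕ) : Prop :=
  r = 0 ∨ r = 1 ∧ n = (t + 1) * (k - t + 1) ∧ m = n ∧ k = l ∧ t + 1 ≤ k

/-- The extremal pairs. -/
def IsExtremal (t n k m l : ℕ) (𝒜 ℬ : Finset (Finset ℕ)) : Prop :=
  ∃ r T, IsExtremalIndex r t n k m l ∧ T ⊆ Icc 1 (max n m) ∧ #T = t + 2 * r ∧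
    𝒜 = frankl n k (t + r) T ∧ ℬ = frankl m l (t + r) T

lemma isExtremal_of_isShifted (h : IsOptimal t n k m l 𝒜 ℬ) (hp : Admissible t n k m l)
    (h𝒜 : IsShifted 𝒜) (hℬ : IsShifted ℬ) : IsExtremal t n k m l 𝒜 ℬ := by
  classical
  have hex : ∃ s, TraceCross t s 𝒜 ℬ :=
    ⟨_, trace_cross_of_isShifted h.toIsCross h𝒜 hp.le_left⟩
  obtain ⟨s, hs, hmin⟩ : ∃ s, TraceCross t s 𝒜 ℬ ∧ ∀ s' < s, ¬ TraceCross t s' 𝒜 ℬ :=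
    ⟨Nat.find hex, Nat.find_spec hex, fun s' hs' => Nat.find_min hex hs'⟩
  have hsk : s ≤ k + l - t := by
    by_contra! hlt
    exact hmin _ hlt (trace_cross_of_isShifted h.toIsCross h𝒜 hp.le_left)
  have hts : t ≤ s := by
    obtain ⟨A, hA⟩ := h.left_nonempty hp
    have h1 := (card_mem_trace h hp hs (mem_trace.2 ⟨A, hA, rfl⟩)).1
    have h2 := card_le_card (inter_subset_right (s₁ := A) (s₂ := Icc 1 s))
    rw [Nat.card_Icc] at h2
    omega
  have hn := hp.le_n
  have ht3 := hp.three_le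
  rcases hts.eq_or_lt with rfl | hts
  · refine ⟨0, Icc 1 t, Or.inl rfl,
      Icc_subset_Icc_right ((by omega : t ≤ n).trans (le_max_left _ _)),
      by simp, ?_⟩
    refine h.eq_of_subset hp (isCross_frankl (by simp; omega)) ?_ ?_
    · exact fun A hA => mem_filter.2 ⟨h.left hA,
        (card_mem_trace h hp hs (mem_trace.2 ⟨A, hA, rfl⟩)).1⟩
    · exact fun B hB => mem_filter.2 ⟨h.right hB,
        (card_mem_trace h.symm hp.symm hs.symm (mem_trace.2 ⟨B, hB, rfl⟩)).1⟩
  · obtain ⟨A, hA, B, hB, hlt⟩ : ∃ A ∈ 𝒜, ∃ B ∈ ℬ,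
        #(A ∩ Icc 1 (s - 1) ∩ (B ∩ Icc 1 (s - 1))) < t := by
      have := hmin (s - 1) (by omega)
      simpa [TraceCross, mem_trace] using this
    have hEt : A ∩ Icc 1 s ∈ trace s 𝒜 := mem_trace.2 ⟨A, hA, rfl⟩
    have hFt : B ∩ Icc 1 s ∈ trace s ℬ := mem_trace.2 ⟨B, hB, rfl⟩
    have heq : (A ∩ Icc 1 s ∩ (B ∩ Icc 1 s)).erase s =
        A ∩ Icc 1 (s - 1) ∩ (B ∩ Icc 1 (s - 1)) := by
      ext x
      simp only [mem_erase, mem_inter, mem_Icc]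
      constructor
      · rintro ⟨h1, ⟨h2, h3⟩, h4, h5⟩; exact ⟨⟨h2, by omega⟩, h4, by omega⟩
      · rintro ⟨⟨h2, h3⟩, h4, h5⟩; exact ⟨by omega, ⟨h2, by omega⟩, h4, by omega⟩
    have hle := hs _ hEt _ hFt
    generalize A ∩ Icc 1 s = E at hEt heq hle
    generalize B ∩ Icc 1 s = F at hFt heq hle
    rw [← heq] at hlt
    have hsEF : s ∈ E ∩ F := by
      by_contra hsEF
      rw [erase_eq_of_notMem hsEF] at hlt
      omega
    obtain ⟨hsE, hsF⟩ := mem_inter.1 hsEF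
    have hEF : #(E ∩ F) ≤ t := by
      rw [card_erase_of_mem hsEF] at hlt; omega
    have hsum := card_add_card_of_card_inter hs h𝒜 hEt hFt hsE hsF hEF
    have hEc : E ∈ critical s #E 𝒜 := mem_critical.2 ⟨hEt, hsE, rfl, fun h' => by
      have := hs _ h' _ hFt
      rw [erase_inter] at this
      omega⟩
    have hFc : F ∈ critical s #F ℬ := mem_critical.2 ⟨hFt, hsF, rfl, fun h' => by
      have := hs _ hEt _ h'
      rw [inter_erase] at this
      omega⟩
    obtain ⟨d, hd⟩ := Nat.exists_eq_add_of_le (card_mem_trace h hp hs hEt).1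
    obtain ⟨c, hc⟩ := Nat.exists_eq_add_of_le (card_mem_trace h.symm hp.symm hs.symm hFt).1
    have hEne : (critical s (t + d) 𝒜).Nonempty := ⟨E, hd ▸ hEc⟩
    have hFne : (critical s (t + c) ℬ).Nonempty := ⟨F, hc ▸ hFc⟩
    have hscd : s = t + c + d := by omega
    rcases Nat.eq_zero_or_pos d with rfl | hd0
    · exact (false_of_critical_full h hp hs h𝒜 hℬ hsk hts hEne
        (by rwa [show s = t + c by omega] at hFne ⊢)).elim
    rcases Nat.eq_zero_or_pos c with rfl | hc0
    · exact (false_of_critical_full h.symm hp.symm hs.symm hℬ h𝒜 (by omega) hts hFne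
        (by rwa [show s = t + d by omega] at hEne ⊢)).elim
    by_cases hlarge : 2 ≤ c ∧ d ≤ c
    · exact (false_of_critical_large h hp hs h𝒜 hℬ hsk hscd hd0 hlarge.2 hlarge.1 hEne hFne).elim
    by_cases hlarge' : 2 ≤ d ∧ c ≤ d
    · exact (false_of_critical_large h.symm hp.symm hs.symm hℬ h𝒜 (by omega) (by omega) hc0
        hlarge'.2 hlarge'.1 hFne hEne).elim
    obtain rfl : c = 1 := by omega
    obtain rfl : d = 1 := by omega
    obtain rfl : s = t + 2 := by omega
    obtain ⟨h1, h2, h3, h4⟩ := balanced_equality h hp hs h𝒜 hℬ hEne hFne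
    have hk := le_of_mem_critical h hp hs hEne.choose_spec
    have h5 := hp.left_right
    have h6 := hp.right_left
    have h7 := hp.le_right
    rw [h3] at h5
    rw [h4] at h6
    have h8 := le_of_mul_le_mul_left h5 (by omega)
    have h9 := le_of_mul_le_mul_left h6 (by omega)
    obtain rfl : k = l := by omega
    refine ⟨1, Icc 1 (t + 2), Or.inr ⟨rfl, h3, h4.trans h3.symm, rfl, hk⟩,
      Icc_subset_Icc_right ((by omega : t + 2 ≤ n).trans (le_max_left _ _)), by simp, ?_⟩
    exact h.eq_of_subset hp (isCross_frankl (by simp; omega)) (subset_frankl h hp hs h2)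
      (subset_frankl h.symm hp.symm hs.symm h1)

end Balanced

section Shift

variable {t n k m l x y : ℕ} {𝒜 ℬ : Finset (Finset ℕ)} {A B T : Finset ℕ}

/-- Replace `y` by `x` in `A`, if this creates a set outside `𝒜`. -/
def shiftSet (x y : ℕ) (𝒜 : Finset (Finset ℕ)) (A : Finset ℕ) : Finset ℕ :=
  if y ∈ A ∧ x ∉ A ∧ insert x (A.erase y) ∉ 𝒜 then insert x (A.erase y) else A

/-- The `(x, y)`-shift of a family. -/
def shift (x y : ℕ) (𝒜 : Finset (Finset ℕ)) : Finset (Finset ℕ) := 𝒜.image (shiftSet x y 𝒜)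

lemma insert_erase_insert_erase (hx : x ∈ A) (hy : y ∉ A) :
    insert x ((insert y (A.erase x)).erase y) = A := by
  rw [erase_insert (fun h => hy (mem_of_mem_erase h)), insert_erase hx]

lemma card_insert_erase (hy : y ∈ A) (hx : x ∉ A) : #(insert x (A.erase y)) = #A := by
  rw [card_insert_of_notMem (fun h => hx (mem_of_mem_erase h)), card_erase_add_one hy]

lemma shiftSet_injOn : Set.InjOn (shiftSet x y 𝒜) 𝒜 := by
  intro A hA B hB hAB
  unfold shiftSet at hAB
  split_ifs at hAB with h1 h2 h2
  · have h3 : insert y ((insert x (A.erase y)).erase x) = A :=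
      insert_erase_insert_erase h1.1 h1.2.1
    rw [← h3, hAB, insert_erase_insert_erase h2.1 h2.2.1]
  · exact absurd (hAB ▸ hB) h1.2.2
  · exact absurd (hAB ▸ hA) h2.2.2
  · exact hAB

lemma card_shift : #(shift x y 𝒜) = #𝒜 := card_image_of_injOn shiftSet_injOn

lemma mem_shift (hxy : x ≠ y) : A ∈ shift x y 𝒜 ↔
    (A ∈ 𝒜 ∧ (y ∈ A → x ∉ A → insert x (A.erase y) ∈ 𝒜)) ∨
      (x ∈ A ∧ y ∉ A ∧ insert y (A.erase x) ∈ 𝒜) := by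
  simp only [shift, mem_image, shiftSet]
  constructor
  · rintro ⟨B, hB, rfl⟩
    split_ifs with h
    · refine Or.inr ⟨mem_insert_self _ _, ?_, ?_⟩
      · simp [hxy.symm]
      · rwa [insert_erase_insert_erase h.1 h.2.1]
    · refine Or.inl ⟨hB, fun h1 h2 => ?_⟩
      by_contra h3
      exact h ⟨h1, h2, h3⟩
  · rintro (⟨hA, h⟩ | ⟨hx, hy, hA⟩)
    · exact ⟨A, hA, if_neg fun h' => h'.2.2 (h h'.1 h'.2.1)⟩
    · by_cases hA' : A ∈ 𝒜
      · exact ⟨A, hA', if_neg fun h' => hy h'.1⟩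
      · refine ⟨_, hA, ?_⟩
        rw [insert_erase_insert_erase hx hy, if_pos]
        exact ⟨mem_insert_self _ _, by simp [hxy], hA'⟩

lemma mem_shift_insert_left (hxy : x ≠ y) (hx : x ∉ A) (hy : y ∉ A) :
    insert x A ∈ shift x y 𝒜 ↔ insert x A ∈ 𝒜 ∨ insert y A ∈ 𝒜 := by
  rw [mem_shift hxy, erase_insert hx]
  simp [hxy.symm, hy]

lemma mem_shift_insert_right (hxy : x ≠ y) (hx : x ∉ A) (hy : y ∉ A) :
    insert y A ∈ shift x y 𝒜 ↔ insert x A ∈ 𝒜 ∧ insert y A ∈ 𝒜 := by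
  rw [mem_shift hxy, erase_insert hy]
  simp [hxy, hx, and_comm]

lemma mem_shift_of_iff (hxy : x ≠ y) (h : x ∈ A ↔ y ∈ A) : A ∈ shift x y 𝒜 ↔ A ∈ 𝒜 := by
  rw [mem_shift hxy]
  tauto

lemma insert_erase_mem_level (hy : y ∈ A) (hx : x ∉ A) (hxn : x ∈ Icc 1 n) (hA : A ∈ level n k) :
    insert x (A.erase y) ∈ level n k := by
  have hA := mem_powersetCard.1 hA
  exact mem_powersetCard.2 ⟨insert_subset hxn ((erase_subset _ _).trans hA.1),
    (card_insert_erase hy hx).trans hA.2⟩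

lemma shift_subset_level (hx : 1 ≤ x) (hxy : x < y) (h : 𝒜 ⊆ level n k) :
    shift x y 𝒜 ⊆ level n k := by
  intro A hA
  rcases (mem_shift hxy.ne).1 hA with hA | ⟨hxA, hyA, hA⟩
  · exact h hA.1
  · have hA := h hA
    rw [← insert_erase_insert_erase hxA hyA]
    have hy := mem_Icc.1 ((mem_powersetCard.1 hA).1 (mem_insert_self _ _))
    exact insert_erase_mem_level (mem_insert_self _ _) (by simp [hxy.ne])
      (mem_Icc.2 (by omega)) hA

lemma le_card_inter_of_swap (hxy : x ≠ y) (h : ∀ B ∈ ℬ, t ≤ #(insert y (A.erase x) ∩ B))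
    (hxA : x ∈ A) (hyA : y ∉ A) (hB : B ∈ ℬ) (hB' : y ∈ B → x ∉ B → insert x (B.erase y) ∈ ℬ) :
    t ≤ #(A ∩ B) := by
  by_cases hyB : y ∈ B
  · by_cases hxB : x ∈ B
    · refine (h B hB).trans_eq ?_
      rw [← card_insert_erase (mem_inter.2 ⟨hxA, hxB⟩) (fun h => hyA (mem_inter.1 h).1),
        insert_inter_of_mem hyB, erase_inter]
    · refine (h _ (hB' hyB hxB)).trans (card_le_card ?_)
      intro z hz
      simp only [mem_inter, mem_insert, mem_erase] at hz ⊢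
      grind
  · refine (h B hB).trans (card_le_card ?_)
    rw [insert_inter_of_notMem hyB]
    exact inter_subset_inter (erase_subset _ _) subset_rfl

lemma IsCross.shift (h : IsCross t n k m l 𝒜 ℬ) (hx : 1 ≤ x) (hxy : x < y) :
    IsCross t n k m l (shift x y 𝒜) (shift x y ℬ) := by
  refine ⟨shift_subset_level hx hxy h.left, shift_subset_level hx hxy h.right,
    fun A hA B hB => ?_⟩
  rcases (mem_shift hxy.ne).1 hA with hA | ⟨hxA, hyA, hA⟩
  · rcases (mem_shift hxy.ne).1 hB with hB | ⟨hxB, hyB, hB⟩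
    · exact h.cross A hA.1 B hB.1
    · rw [inter_comm]
      exact le_card_inter_of_swap hxy.ne
        (fun A' hA' => by rw [inter_comm]; exact h.cross A' hA' _ hB) hxB hyB hA.1 hA.2
  · rcases (mem_shift hxy.ne).1 hB with hB | ⟨hxB, hyB, hB⟩
    · exact le_card_inter_of_swap hxy.ne (h.cross _ hA) hxA hyA hB.1 hB.2
    · refine (h.cross _ hA _ hB).trans_eq ?_
      rw [← card_insert_erase (mem_inter.2 ⟨hxA, hxB⟩) (fun h => hyA (mem_inter.1 h).1),
        ← insert_inter_distrib, erase_inter, inter_erase, erase_idem]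

lemma IsOptimal.shift (h : IsOptimal t n k m l 𝒜 ℬ) (hx : 1 ≤ x) (hxy : x < y) :
    IsOptimal t n k m l (shift x y 𝒜) (shift x y ℬ) :=
  ⟨h.toIsCross.shift hx hxy, fun 𝒜' ℬ' h' => by
    rw [card_shift, card_shift]; exact h.le 𝒜' ℬ' h'⟩

/-- The sum of all elements of all members of a family. -/
def weight (𝒜 : Finset (Finset ℕ)) : ℕ := ∑ A ∈ 𝒜, A.sum id

lemma sum_insert_erase_lt (hxy : x < y) (hy : y ∈ A) (hx : x ∉ A) :
    (insert x (A.erase y)).sum id < A.sum id := by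
  rw [sum_insert (fun h => hx (mem_of_mem_erase h))]
  have := add_sum_erase A id hy
  simp only [id] at this ⊢
  omega

lemma sum_shiftSet_le (hxy : x < y) : (shiftSet x y 𝒜 A).sum id ≤ A.sum id := by
  unfold shiftSet
  split_ifs with h
  · exact (sum_insert_erase_lt hxy h.1 h.2.1).le
  · exact le_rfl

lemma weight_shift_le (hxy : x < y) : weight (shift x y 𝒜) ≤ weight 𝒜 := by
  rw [weight, shift, sum_image shiftSet_injOn]
  exact sum_le_sum fun A _ => sum_shiftSet_le hxy

lemma weight_shift_lt (hxy : x < y) (hA : A ∈ 𝒜) (hy : y ∈ A) (hx : x ∉ A)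
    (hA' : insert x (A.erase y) ∉ 𝒜) : weight (shift x y 𝒜) < weight 𝒜 := by
  rw [weight, shift, sum_image shiftSet_injOn]
  refine sum_lt_sum (fun A _ => sum_shiftSet_le hxy) ⟨A, hA, ?_⟩
  rw [shiftSet, if_pos ⟨hy, hx, hA'⟩]
  exact sum_insert_erase_lt hxy hy hx

end Shift

section Unshift

variable {t n k m l a r x y u v : ℕ} {𝒜 ℬ : Finset (Finset ℕ)} {A B T : Finset ℕ}

/-- Sets which become members of `frankl n k a T` on adding a further element of `T`. -/
structure IsPivot (n k a x y : ℕ) (T A : Finset ℕ) : Prop where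
  subset : A ⊆ Icc 1 n
  card : #A + 1 = k
  left : x ∉ A
  right : y ∉ A
  inter : #(A ∩ T) + 1 = a

lemma exists_isPivot_neighbor (hp : Admissible t n k m l) (hxT : x ∈ T) (hyT : y ∉ T)
    (hTm : T ⊆ Icc 1 m) (hr : r ≤ 1) (hl : t + r ≤ l) (hT : #T = t + 2 * r)
    {A₁ A₂ : Finset ℕ} (h₁ : IsPivot n k (t + r) x y T A₁) (h₂ : IsPivot n k (t + r) x y T A₂) :
    ∃ B, IsPivot m l (t + r) x y T B ∧ #(A₁ ∩ B) < t ∧ #(A₂ ∩ B) < t := by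
  have ht := hp.three_le
  have hm := hp.symm.le_n
  have hT0 : #(T.erase x) + 1 = t + 2 * r := by rw [card_erase_add_one hxT, hT]
  have hA₁ : A₁ ∩ T ⊆ T.erase x :=
    subset_erase.2 ⟨inter_subset_right, fun h => h₁.left (mem_inter.1 h).1⟩
  have hA₂ : A₂ ∩ T ⊆ T.erase x :=
    subset_erase.2 ⟨inter_subset_right, fun h => h₂.left (mem_inter.1 h).1⟩
  have hi₁ := h₁.inter
  have hi₂ := h₂.inter
  have hc₁ := h₁.card
  have hc₂ := h₂.card
  obtain ⟨U, hU, hUr⟩ : ∃ U ⊆ A₁ ∩ T ∩ (A₂ ∩ T), #U = r := by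
    refine exists_subset_card_eq ?_
    have h1 := card_union_add_card_inter (A₁ ∩ T) (A₂ ∩ T)
    have h2 := card_le_card (union_subset hA₁ hA₂)
    omega
  obtain ⟨D, hD, hDl⟩ : ∃ D ⊆ Icc 1 m \ (insert y (T ∪ (A₁ \ T ∪ A₂ \ T))), #D = l - (t + r) := by
    refine exists_subset_card_eq ?_
    have h1 := le_card_sdiff (insert y (T ∪ (A₁ \ T ∪ A₂ \ T))) (Icc 1 m)
    have h2 := card_insert_le y (T ∪ (A₁ \ T ∪ A₂ \ T))
    have h3 := card_union_le T (A₁ \ T ∪ A₂ \ T)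
    have h4 := card_union_le (A₁ \ T) (A₂ \ T)
    have h5 := card_sdiff_add_card_inter A₁ T
    have h6 := card_sdiff_add_card_inter A₂ T
    rw [Nat.card_Icc] at h1
    omega
  have hD' : ∀ z ∈ D, z ∈ Icc 1 m ∧ z ≠ y ∧ z ∉ T ∧ z ∉ A₁ ∧ z ∉ A₂ := by
    intro z hz
    have := hD hz
    simp only [mem_sdiff, mem_insert, mem_union] at this
    tauto
  have hDT : Disjoint D T := disjoint_left.2 fun z hz => (hD' z hz).2.2.1
  have hUT : U ⊆ T.erase x := (hU.trans inter_subset_left).trans hA₁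
  have hTU : #(T.erase x \ U) + r = #(T.erase x) := by
    rw [card_sdiff_of_subset hUT, hUr]
    exact Nat.sub_add_cancel (hUr ▸ card_le_card hUT)
  have hlt : ∀ A, #(A ∩ T) + 1 = t + r → U ⊆ A ∩ T → (∀ z ∈ D, z ∉ A) →
      #(A ∩ (T.erase x \ U ∪ D)) < t := by
    intro A hA hUA hDA
    have h1 : A ∩ (T.erase x \ U ∪ D) ⊆ (A ∩ T) \ U := by
      intro z hz
      simp only [mem_inter, mem_union, mem_sdiff, mem_erase] at hz ⊢
      have := hDA z
      tauto
    have h2 := card_le_card h1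
    rw [card_sdiff_of_subset hUA] at h2
    omega
  refine ⟨T.erase x \ U ∪ D, ⟨?_, ?_, ?_, ?_, ?_⟩,
    hlt A₁ hi₁ (hU.trans inter_subset_left) fun z hz => (hD' z hz).2.2.2.1,
    hlt A₂ hi₂ (hU.trans inter_subset_right) fun z hz => (hD' z hz).2.2.2.2⟩
  · exact union_subset ((sdiff_subset.trans (erase_subset _ _)).trans hTm) fun z hz => (hD' z hz).1
  · rw [card_union_of_disjoint (disjoint_of_subset_left
      (sdiff_subset.trans (erase_subset _ _)) hDT.symm)]
    omega
  · simp only [mem_union, mem_sdiff, mem_erase]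
    have := hD' x
    tauto
  · simp only [mem_union, mem_sdiff, mem_erase]
    have := hD' y
    tauto
  · rw [union_inter_distrib_right, disjoint_iff_inter_eq_empty.1 hDT, union_empty,
      inter_eq_left.2 (sdiff_subset.trans (erase_subset _ _))]
    omega

lemma insert_notMem_of_card_inter_lt (h : IsCross t n k m l 𝒜 ℬ) (huv : u ≠ v) (hvA : v ∉ A)
    (huB : u ∉ B) (hAB : #(A ∩ B) < t) (hA : insert u A ∈ 𝒜) : insert v B ∉ ℬ := fun hB => by
  have := h.cross _ hA _ hB
  rw [insert_inter_of_notMem (by simp [huv, huB]), inter_insert_of_notMem hvA] at this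
  omega

lemma IsPivot.notMem (h : IsPivot n k a x y T A) (hu : u = x ∨ u = y) : u ∉ A := by
  rcases hu with rfl | rfl
  exacts [h.left, h.right]

lemma IsPivot.insert_mem (h : IsCross t n k m l 𝒜 ℬ) (hA : IsPivot n k a x y T A)
    (hB : IsPivot m l a x y T B) (hAB : #(A ∩ B) < t) (huv : u ≠ v) (hu : u = x ∨ u = y)
    (hv : v = x ∨ v = y) (hℬ : insert u B ∈ ℬ ∨ insert v B ∈ ℬ) (huA : insert u A ∈ 𝒜) :
    insert u B ∈ ℬ :=
  hℬ.resolve_right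
    (insert_notMem_of_card_inter_lt h huv (hA.notMem hv) (hB.notMem hu) hAB huA)

lemma subset_frankl_of_shift (hxy : x ≠ y) (hT : x ∈ T → y ∈ T) (h𝒜 : 𝒜 ⊆ level n k)
    (h : shift x y 𝒜 ⊆ frankl n k a T) : 𝒜 ⊆ frankl n k a T := by
  intro A hA
  by_cases hyA : y ∈ A ∧ x ∉ A
  · have h1 : insert x (A.erase y) ∈ shift x y 𝒜 := by
      rw [mem_shift_insert_left hxy (fun h => hyA.2 (mem_of_mem_erase h)) (notMem_erase _ _),
        insert_erase hyA.1]
      exact Or.inr hA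
    refine mem_filter.2 ⟨h𝒜 hA, (mem_filter.1 (h h1)).2.trans ?_⟩
    by_cases hxT : x ∈ T
    · rw [insert_inter_of_mem hxT, erase_inter, card_insert_erase (mem_inter.2 ⟨hyA.1, hT hxT⟩)
        (fun h => hyA.2 (mem_inter.1 h).1)]
    · rw [insert_inter_of_notMem hxT]
      exact card_le_card (inter_subset_inter (erase_subset _ _) subset_rfl)
  · exact h ((mem_shift hxy).2 (Or.inl ⟨hA, fun h1 h2 => absurd ⟨h1, h2⟩ hyA⟩))

lemma isPivot_erase (hA : A ∈ level n k) (huA : u ∈ A) (hx : x ∉ A.erase u) (hy : y ∉ A.erase u)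
    (hT : #(A.erase u ∩ T) + 1 = a) : IsPivot n k a x y T (A.erase u) :=
  have hA := mem_powersetCard.1 hA
  ⟨(erase_subset _ _).trans hA.1, (card_erase_add_one huA).trans hA.2, hx, hy, hT⟩

lemma IsPivot.mem_or (hxy : x ≠ y) (hxT : x ∈ T) (hTn : T ⊆ Icc 1 n)
    (h : shift x y 𝒜 = frankl n k a T) (hA : IsPivot n k a x y T A) :
    insert x A ∈ 𝒜 ∨ insert y A ∈ 𝒜 := by
  rw [← mem_shift_insert_left hxy hA.left hA.right, h, mem_filter, mem_powersetCard]
  refine ⟨⟨insert_subset (hTn hxT) hA.subset, ?_⟩, ?_⟩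
  · rw [card_insert_of_notMem hA.left, hA.card]
  · rw [insert_inter_of_mem hxT, card_insert_of_notMem (fun h => hA.left (mem_inter.1 h).1),
      hA.inter]

lemma subset_frankl_of_pivot (hxy : x ≠ y) (hxT : x ∈ T) (h𝒜 : 𝒜 ⊆ level n k)
    (h : shift x y 𝒜 ⊆ frankl n k a T)
    (hP : ∀ A, IsPivot n k a x y T A → insert x A ∈ 𝒜) : 𝒜 ⊆ frankl n k a T := by
  intro A hA
  by_cases hyA : y ∈ A ∧ x ∉ A
  · have hx : x ∉ A.erase y := fun h => hyA.2 (mem_of_mem_erase h)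
    have h1 : insert x (A.erase y) ∈ shift x y 𝒜 := by
      rw [mem_shift_insert_left hxy hx (notMem_erase _ _), insert_erase hyA.1]
      exact Or.inr hA
    have h2 := (mem_filter.1 (h h1)).2
    rw [insert_inter_of_mem hxT, card_insert_of_notMem (fun h => hx (mem_inter.1 h).1)] at h2
    rcases h2.eq_or_lt with h2 | h2
    · refine h ((mem_shift hxy).2 (Or.inl ⟨hA, fun _ _ => hP _ ?_⟩))
      exact isPivot_erase (h𝒜 hA) hyA.1 hx (notMem_erase _ _) h2.symm
    · refine mem_filter.2 ⟨h𝒜 hA, ?_⟩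
      have := card_le_card (inter_subset_inter (erase_subset y A) (subset_refl T))
      omega
  · exact h ((mem_shift hxy).2 (Or.inl ⟨hA, fun h1 h2 => absurd ⟨h1, h2⟩ hyA⟩))

lemma subset_frankl_swap_of_pivot (hxy : x ≠ y) (hxT : x ∈ T) (hyT : y ∉ T)
    (h𝒜 : 𝒜 ⊆ level n k) (h : shift x y 𝒜 ⊆ frankl n k a T)
    (hP : ∀ A, IsPivot n k a x y T A → insert y A ∈ 𝒜) :
    𝒜 ⊆ frankl n k a (insert y (T.erase x)) := by
  intro A hA
  refine mem_filter.2 ⟨h𝒜 hA, ?_⟩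
  by_cases hyA : y ∈ A
  · by_cases hxA : x ∈ A
    · have h1 : A ∈ shift x y 𝒜 := (mem_shift_of_iff hxy (iff_of_true hxA hyA)).2 hA
      refine (mem_filter.1 (h h1)).2.trans_eq ?_
      rw [inter_insert_of_mem hyA, inter_erase, card_insert_erase (mem_inter.2 ⟨hxA, hxT⟩)
        (fun h => hyT (mem_inter.1 h).2)]
    · have hx : x ∉ A.erase y := fun h => hxA (mem_of_mem_erase h)
      have h1 : insert x (A.erase y) ∈ shift x y 𝒜 := by
        rw [mem_shift_insert_left hxy hx (notMem_erase _ _), insert_erase hyA]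
        exact Or.inr hA
      refine (mem_filter.1 (h h1)).2.trans ?_
      rw [insert_inter_of_mem hxT, card_insert_of_notMem (fun h => hx (mem_inter.1 h).1),
        inter_insert_of_mem hyA, inter_erase, card_insert_of_notMem
          (fun h => hyT (mem_inter.1 (mem_of_mem_erase h)).2)]
      refine Nat.add_le_add_right (card_le_card ?_) 1
      intro z hz
      simp only [mem_inter, mem_erase] at hz ⊢
      exact ⟨fun h => hxA (h ▸ hz.1.2), hz.1.2, hz.2⟩
  · have h1 : A ∈ shift x y 𝒜 := (mem_shift hxy).2 (Or.inl ⟨hA, fun h => absurd h hyA⟩)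
    have h2 := (mem_filter.1 (h h1)).2
    rw [inter_insert_of_notMem hyA, inter_erase]
    by_cases hxA : x ∈ A
    · have h3 := card_erase_add_one (mem_inter.2 ⟨hxA, hxT⟩)
      rcases h2.eq_or_lt with h2 | h2
      · exfalso
        have hy : y ∉ A.erase x := fun h => hyA (mem_of_mem_erase h)
        have h4 := hP _ (isPivot_erase (h𝒜 hA) hxA (notMem_erase _ _) hy
          (by rw [erase_inter, h3, h2]))
        have h5 := (mem_shift_insert_right hxy (notMem_erase _ _) hy).2
          ⟨by rwa [insert_erase hxA], h4⟩
        have h6 := (mem_filter.1 (h h5)).2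
        rw [insert_inter_of_notMem hyT, erase_inter] at h6
        omega
      · omega
    · rwa [erase_eq_of_notMem (fun h => hxA (mem_inter.1 h).1)]

lemma exists_subset_frankl_of_shift (h : IsCross t n k m l 𝒜 ℬ) (hp : Admissible t n k m l)
    (hxy : x ≠ y) (hr : r ≤ 1) (hk : t + r ≤ k) (hl : t + r ≤ l) (hT : #T = t + 2 * r)
    (hTn : T ⊆ Icc 1 n) (hTm : T ⊆ Icc 1 m)
    (h𝒜 : shift x y 𝒜 = frankl n k (t + r) T) (hℬ : shift x y ℬ = frankl m l (t + r) T) :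
    ∃ T' ⊆ insert y T, #T' = t + 2 * r ∧ 𝒜 ⊆ frankl n k (t + r) T' ∧
      ℬ ⊆ frankl m l (t + r) T' := by
  by_cases hxT : x ∈ T → y ∈ T
  · exact ⟨T, subset_insert _ _, hT, subset_frankl_of_shift hxy hxT h.left h𝒜.subset,
      subset_frankl_of_shift hxy hxT h.right hℬ.subset⟩
  · push Not at hxT
    obtain ⟨hxT, hyT⟩ := hxT
    have hor𝒜 := fun A (hA : IsPivot n k (t + r) x y T A) => hA.mem_or hxy hxT hTn h𝒜
    have horℬ := fun B (hB : IsPivot m l (t + r) x y T B) => hB.mem_or hxy hxT hTm hℬ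
    have hall : ∀ {u v : ℕ}, u ≠ v → (u = x ∨ u = y) → (v = x ∨ v = y) →
        (∀ B, IsPivot m l (t + r) x y T B → insert u B ∈ ℬ ∨ insert v B ∈ ℬ) →
        (∀ A, IsPivot n k (t + r) x y T A → insert u A ∈ 𝒜) →
        ∀ B, IsPivot m l (t + r) x y T B → insert u B ∈ ℬ := by
      intro u v huv hu hv hor hA B hB
      obtain ⟨A, hA', hAB, -⟩ := exists_isPivot_neighbor hp.symm hxT hyT hTn hr hk hT hB hB
      rw [inter_comm] at hAB
      exact IsPivot.insert_mem h hA' hB hAB huv hu hv (hor B hB) (hA A hA')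
    by_cases hex : ∃ A, IsPivot n k (t + r) x y T A ∧ insert x A ∈ 𝒜
    · obtain ⟨A, hA, hxA⟩ := hex
      have hP : ∀ A, IsPivot n k (t + r) x y T A → insert x A ∈ 𝒜 := by
        intro A' hA'
        obtain ⟨B, hB, hAB, hA'B⟩ := exists_isPivot_neighbor hp hxT hyT hTm hr hl hT hA hA'
        rw [inter_comm] at hA'B
        have h1 := IsPivot.insert_mem h hA hB hAB hxy (Or.inl rfl) (Or.inr rfl) (horℬ B hB) hxA
        exact IsPivot.insert_mem h.symm hB hA' hA'B hxy (Or.inl rfl) (Or.inr rfl) (hor𝒜 A' hA') h1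
      exact ⟨T, subset_insert _ _, hT, subset_frankl_of_pivot hxy hxT h.left h𝒜.subset hP,
        subset_frankl_of_pivot hxy hxT h.right hℬ.subset
          (hall hxy (Or.inl rfl) (Or.inr rfl) horℬ hP)⟩
    · have hP : ∀ A, IsPivot n k (t + r) x y T A → insert y A ∈ 𝒜 := fun A hA =>
        (hor𝒜 A hA).resolve_left fun hxA => hex ⟨A, hA, hxA⟩
      exact ⟨insert y (T.erase x), insert_subset_insert _ (erase_subset _ _),
        (card_insert_erase hxT hyT).trans hT,
        subset_frankl_swap_of_pivot hxy hxT hyT h.left h𝒜.subset hP,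
        subset_frankl_swap_of_pivot hxy hxT hyT h.right hℬ.subset
          (hall hxy.symm (Or.inr rfl) (Or.inl rfl) (fun B hB => (horℬ B hB).symm) hP)⟩

lemma subset_Icc_of_frankl_nonempty (hi : IsExtremalIndex r t n k m l) (hT : #T = t + 2 * r)
    (hTn : T ⊆ Icc 1 (max n m)) (hne : (frankl n k (t + r) T).Nonempty) : T ⊆ Icc 1 n := by
  rcases hi with rfl | ⟨rfl, -, rfl, -⟩
  · obtain ⟨A, hA⟩ := hne
    rw [add_zero, ← (hT.trans (by simp) : #T = t), ← star_eq_frankl, mem_filter] at hA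
    exact hA.2.trans (mem_powersetCard.1 hA.1).1
  · rwa [max_self] at hTn

lemma IsExtremalIndex.symm (h : IsExtremalIndex r t n k m l) : IsExtremalIndex r t m l n k := by
  rcases h with rfl | ⟨rfl, h1, rfl, rfl, h2⟩
  · exact Or.inl rfl
  · exact Or.inr ⟨rfl, h1, rfl, rfl, h2⟩

lemma IsExtremalIndex.add_le (h : IsExtremalIndex r t n k m l) (hk : t ≤ k) : t + r ≤ k := by
  rcases h with rfl | ⟨rfl, -, -, -, h⟩ <;> omega

lemma IsExtremalIndex.le_one (h : IsExtremalIndex r t n k m l) : r ≤ 1 := by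
  rcases h with rfl | ⟨rfl, -⟩ <;> omega

lemma IsOptimal.subset_Icc (h : IsOptimal t n k m l 𝒜 ℬ) (hp : Admissible t n k m l)
    (hi : IsExtremalIndex r t n k m l) (hT : #T = t + 2 * r) (hTn : T ⊆ Icc 1 (max n m))
    (h𝒜 : 𝒜 = frankl n k (t + r) T) : T ⊆ Icc 1 n :=
  subset_Icc_of_frankl_nonempty hi hT hTn (h𝒜 ▸ h.left_nonempty hp)

lemma IsExtremal.of_shift (h : IsOptimal t n k m l 𝒜 ℬ) (hp : Admissible t n k m l) (hx : 1 ≤ x)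
    (hxy : x < y) (hy : y ≤ max n m) (he : IsExtremal t n k m l (shift x y 𝒜) (shift x y ℬ)) :
    IsExtremal t n k m l 𝒜 ℬ := by
  obtain ⟨r, T, hi, hTn, hT, h𝒜, hℬ⟩ := he
  have ho := h.shift hx hxy
  obtain ⟨T', hT', hcard, h1, h2⟩ := exists_subset_frankl_of_shift h.toIsCross hp hxy.ne hi.le_one
    (hi.add_le hp.le_left) (hi.symm.add_le hp.le_right) hT (ho.subset_Icc hp hi hT hTn h𝒜)
    (ho.symm.subset_Icc hp.symm hi.symm hT (max_comm n m ▸ hTn) hℬ) h𝒜 hℬ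
  have h3 := h.eq_of_subset hp (isCross_frankl (by omega)) h1 h2
  exact ⟨r, T', hi, hT'.trans (insert_subset (mem_Icc.2 (by omega)) hTn), hcard, h3.1, h3.2⟩

lemma exists_of_not_isShifted (h : ¬ IsShifted 𝒜) : ∃ A ∈ 𝒜, ∃ x y, 1 ≤ x ∧ x < y ∧ y ∈ A ∧
    x ∉ A ∧ insert x (A.erase y) ∉ 𝒜 := by
  unfold IsShifted at h
  push Not at h
  exact h

/-- Every optimal pair is extremal. -/
lemma isExtremal_of_isOptimal (h : IsOptimal t n k m l 𝒜 ℬ) (hp : Admissible t n k m l) :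
    IsExtremal t n k m l 𝒜 ℬ := by
  induction hw : weight 𝒜 + weight ℬ using Nat.strong_induction_on generalizing 𝒜 ℬ with
  | _ w ih =>
  subst hw
  by_cases h𝒜 : IsShifted 𝒜
  · by_cases hℬ : IsShifted ℬ
    · exact isExtremal_of_isShifted h hp h𝒜 hℬ
    · obtain ⟨B, hB, x, y, hx, hxy, hyB, hxB, hB'⟩ := exists_of_not_isShifted hℬ
      have hy := mem_Icc.1 ((mem_powersetCard.1 (h.right hB)).1 hyB)
      exact (ih _ (Nat.add_lt_add_of_le_of_lt (weight_shift_le hxy)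
        (weight_shift_lt hxy hB hyB hxB hB')) (h.shift hx hxy) rfl).of_shift h hp hx hxy
        (le_max_of_le_right hy.2)
  · obtain ⟨A, hA, x, y, hx, hxy, hyA, hxA, hA'⟩ := exists_of_not_isShifted h𝒜
    have hy := mem_Icc.1 ((mem_powersetCard.1 (h.left hA)).1 hyA)
    exact (ih _ (Nat.add_lt_add_of_lt_of_le (weight_shift_lt hxy hA hyA hxA hA')
      (weight_shift_le hxy)) (h.shift hx hxy) rfl).of_shift h hp hx hxy (le_max_of_le_left hy.2)

end Unshift

section Count

variable {t n k m l r : ℕ} {𝒜 ℬ : Finset (Finset ℕ)} {T : Finset ℕ}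

lemma card_frankl_of_card_eq_succ {a : ℕ} (hT : #T = a + 1) (hTn : T ⊆ Icc 1 n) (hk : a ≤ k)
    (hn : k + 1 ≤ n) :
    #(frankl n k a T) = (n - a).choose (k - a) +
      a * (n - (a + 1)).choose (k - a) := by
  have hunion : frankl n k a T =
      {A ∈ level n k | A ∩ T ∈ T.powersetCard a} ∪ {A ∈ level n k | T ⊆ A} := by
    ext A
    rw [mem_union, mem_filter, mem_filter, mem_filter, ← and_or_left, mem_powersetCard (t := T)]
    refine and_congr_right fun _ => ?_
    have h1 := card_le_card (inter_subset_right (s₁ := A) (s₂ := T))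
    rw [← inter_eq_right (s := T) (t := A)]
    constructor
    · intro h
      rcases h.eq_or_lt with h | h
      · exact Or.inl ⟨inter_subset_right, h.symm⟩
      · exact Or.inr (eq_of_subset_of_card_le inter_subset_right (by omega))
    · rintro (h | h)
      · exact h.2.ge
      · rw [h]; omega
  have hdisj : Disjoint {A ∈ level n k | A ∩ T ∈ T.powersetCard a} {A ∈ level n k | T ⊆ A} := by
    rw [disjoint_left]
    intro A hA hA'
    have h1 := (mem_powersetCard.1 (mem_filter.1 hA).2).2
    rw [inter_eq_right.2 (mem_filter.1 hA').2] at h1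
    omega
  rw [hunion, card_union_of_disjoint hdisj, card_filter_inter_mem (i := a) hTn
    (fun E hE => mem_powersetCard.1 hE) hk, card_powersetCard, hT, Nat.choose_succ_self_right]
  rcases hk.eq_or_lt with rfl | hk
  · have : {A ∈ level n a | T ⊆ A} = ∅ := by
      refine filter_eq_empty_iff.2 fun A hA hTA => ?_
      have := card_le_card hTA
      have := (mem_powersetCard.1 hA).2
      omega
    rw [this]
    simp
    ring
  · rw [star_eq_frankl, card_star hTn (by omega), hT]
    obtain ⟨c, hc⟩ : ∃ c, k - a = c + 1 := ⟨k - a - 1, by omega⟩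
    rw [show n - a = n - (a + 1) + 1 by omega, show k - (a + 1) = c by omega, hc,
      Nat.choose_succ_succ]
    ring

lemma card_frankl_of_eq (hn : n = (t + 1) * (k - t + 1)) (hk : t + 1 ≤ k) (hT : #T = t + 2)
    (hTn : T ⊆ Icc 1 n) : #(frankl n k (t + 1) T) = (n - t).choose (k - t) := by
  obtain ⟨c, rfl⟩ := Nat.exists_eq_add_of_le hk
  have h1 : n = t + 1 + 1 + (t * (c + 1) + c) := by
    rw [hn, show t + 1 + c - t + 1 = c + 2 by omega]; ring
  rw [card_frankl_of_card_eq_succ hT hTn (by omega) (by nlinarith)]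
  have h2 : (t * (c + 1) + c).choose (c + 1) = (t * (c + 1) + c).choose c * t := by
    have := Nat.choose_succ_right_eq (t * (c + 1) + c) c
    rw [Nat.add_sub_cancel, ← mul_assoc] at this
    exact Nat.eq_of_mul_eq_mul_right (Nat.succ_pos c) this
  rw [show n - t = t * (c + 1) + c + 1 + 1 by omega,
    show n - (t + 1) = t * (c + 1) + c + 1 by omega,
    show n - (t + 1 + 1) = t * (c + 1) + c by omega, show t + 1 + c - t = c + 1 by omega,
    show t + 1 + c - (t + 1) = c by omega, Nat.choose_succ_succ _ c, Nat.choose_succ_succ _ c,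
    Nat.succ_eq_add_one, h2]
  ring

lemma card_frankl_of_isExtremalIndex (hp : Admissible t n k m l)
    (hi : IsExtremalIndex r t n k m l) (hT : #T = t + 2 * r) (hTn : T ⊆ Icc 1 n) :
    #(frankl n k (t + r) T) = (n - t).choose (k - t) := by
  rcases hi with rfl | ⟨rfl, hn, -, -, hk⟩
  · have hT : #T = t := hT
    have := card_star hTn (hT.trans_le hp.le_left)
    rwa [hT] at this
  · exact card_frankl_of_eq hn hk hT hTn

lemma IsOptimal.card_mul_card (h : IsOptimal t n k m l 𝒜 ℬ) (hp : Admissible t n k m l) :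
    #𝒜 * #ℬ = (n - t).choose (k - t) * (m - t).choose (l - t) := by
  obtain ⟨r, T, hi, hTn, hT, h𝒜, hℬ⟩ := isExtremal_of_isOptimal h hp
  have hn := h.subset_Icc hp hi hT hTn h𝒜
  have hm := h.symm.subset_Icc hp.symm hi.symm hT (max_comm n m ▸ hTn) hℬ
  rw [h𝒜, hℬ, card_frankl_of_isExtremalIndex hp hi hT hn,
    card_frankl_of_isExtremalIndex hp.symm hi.symm hT hm]

lemma isOptimal_of_card_mul_card (h : IsCross t n k m l 𝒜 ℬ) (hp : Admissible t n k m l)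
    (hcard : #𝒜 * #ℬ = (n - t).choose (k - t) * (m - t).choose (l - t)) :
    IsOptimal t n k m l 𝒜 ℬ := by
  obtain ⟨𝒜₀, ℬ₀, h₀⟩ := exists_isOptimal t n k m l
  exact ⟨h, fun 𝒜' ℬ' h' => (h₀.le 𝒜' ℬ' h').trans_eq ((h₀.card_mul_card hp).trans hcard.symm)⟩

lemma admissible_of_le_min (ht : 3 ≤ t) (htl : t ≤ l) (hlk : l ≤ k)
    (hmin : (t + 1) * (k - t + 1) ≤ min m n) : Admissible t n k m l := by
  have h1 : (t + 1) * (l - t + 1) ≤ (t + 1) * (k - t + 1) :=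
    Nat.mul_le_mul_left _ (by omega)
  have h2 := hmin.trans (min_le_left _ _)
  have h3 := hmin.trans (min_le_right _ _)
  exact ⟨ht, htl.trans hlk, htl, h3, h1.trans h3, h2, h1.trans h2⟩

end Count

end CrossIntersecting

/-- Characterization of equality in the cross-`t`-intersecting product bound:
for positive integers `n, m, l, k, t` with `3 ≤ t ≤ l ≤ k`, `min{m,n} ≥ (t+1)(k−t+1)` and
cross-`t`-intersecting families `𝒜 ⊆ C([n],k)`, `ℬ ⊆ C([m],l)`, equality
`|𝒜|·|ℬ| = C(n−t,k−t)·C(m−t,l−t)` holds iff either both families are the stars of a common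
`t`-set `T ⊆ [min{m,n}]`, or `n = m = (t+1)(k−t+1)`, `k = l` and
`𝒜 = ℬ = {A : |A ∩ T| ≥ t+1}` for some `(t+2)`-set `T ⊆ [n]`. -/
theorem cross_t_intersecting_equality_characterization
    (n m l k t : ℕ) (ht : 3 ≤ t) (htl : t ≤ l) (hlk : l ≤ k)
    (hmin : (t + 1) * (k - t + 1) ≤ min m n)
    (𝒜 ℬ : Finset (Finset ℕ))
    (h𝒜 : 𝒜 ⊆ (Finset.Icc 1 n).powersetCard k)
    (hℬ : ℬ ⊆ (Finset.Icc 1 m).powersetCard l)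
    (hcross : ∀ A ∈ 𝒜, ∀ B ∈ ℬ, t ≤ (A ∩ B).card) :
    𝒜.card * ℬ.card = (n - t).choose (k - t) * (m - t).choose (l - t) ↔
      ((∃ T : Finset ℕ, T ⊆ Finset.Icc 1 (min m n) ∧ T.card = t ∧
          𝒜 = ((Finset.Icc 1 n).powersetCard k).filter (fun A => T ⊆ A) ∧
          ℬ = ((Finset.Icc 1 m).powersetCard l).filter (fun B => T ⊆ B)) ∨
        (n = (t + 1) * (k - t + 1) ∧ m = (t + 1) * (k - t + 1) ∧ k = l ∧
          ∃ T : Finset ℕ, T ⊆ Finset.Icc 1 n ∧ T.card = t + 2 ∧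
            𝒜 = ((Finset.Icc 1 n).powersetCard k).filter
                  (fun A => t + 1 ≤ (A ∩ T).card) ∧
            ℬ = 𝒜)) := by
  have hp := CrossIntersecting.admissible_of_le_min ht htl hlk hmin
  have hc : CrossIntersecting.IsCross t n k m l 𝒜 ℬ := ⟨h𝒜, hℬ, hcross⟩
  constructor
  · intro hcard
    have ho := CrossIntersecting.isOptimal_of_card_mul_card hc hp hcard
    obtain ⟨r, T, hi, hT, hTc, h1, h2⟩ := CrossIntersecting.isExtremal_of_isOptimal ho hp
    have hn := ho.subset_Icc hp hi hTc hT h1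
    have hm := ho.symm.subset_Icc hp.symm hi.symm hTc (max_comm n m ▸ hT) h2
    rcases hi with rfl | ⟨rfl, hn', rfl, rfl, -⟩
    · have hTc : T.card = t := hTc
      refine Or.inl ⟨T, fun z hz => ?_, hTc, ?_, ?_⟩
      · have h3 := Finset.mem_Icc.1 (hn hz)
        have h4 := Finset.mem_Icc.1 (hm hz)
        exact Finset.mem_Icc.2 ⟨h3.1, le_min h4.2 h3.2⟩
      · rw [CrossIntersecting.star_eq_frankl, hTc]
        exact h1
      · rw [CrossIntersecting.star_eq_frankl, hTc]
        exact h2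
    · exact Or.inr ⟨hn', hn', rfl, T, hn, hTc, h1, h2.trans h1.symm⟩
  · rintro (⟨T, hT, hTc, h1, h2⟩ | ⟨hn, hm, rfl, T, hT, hTc, h1, h2⟩)
    · rw [CrossIntersecting.star_eq_frankl] at h1 h2
      rw [h1, h2, CrossIntersecting.card_star
        (hT.trans (Finset.Icc_subset_Icc_right (min_le_right _ _))) (hTc.trans_le hp.le_left),
        CrossIntersecting.card_star
        (hT.trans (Finset.Icc_subset_Icc_right (min_le_left _ _))) (hTc.trans_le hp.le_right), hTc]
    · obtain rfl : m = n := hm.trans hn.symm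
      have hk : t + 1 ≤ k := by
        by_contra! hlt
        have h3 := Finset.card_le_card hT
        rw [Nat.card_Icc, hTc, hn, show k - t = 0 by omega] at h3
        omega
      rw [h2, h1, CrossIntersecting.card_frankl_of_eq hn hk hTc hT]
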